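/- arXiv:1802.00618 — 2 statements merged into one kernel-verified Lean document; each statement's English description precedes it below -/
import Mathlib

section
/- Let k be a separably closed field and f: X → Spec(k) a semistable morphism. Then every element of the k-strata of X (for every k ≥ 0) is geometrically irreducible. -/
/-!
Common infrastructure for formalizing "Néron models of jacobians over base schemes of
dimension greater than 1" (semistable morphisms, strata, dual graphs, alignment,
specialisation maps, Cartier/Weil divisors, Picard data, Néron models).

Notes on design choices (Mathlib has no algebraic spaces, no Picard functor, no strict
henselisation and no excellent rings):
* Algebraic spaces are replaced by schemes throughout.
* The label of a point of a semistable morphism over a strictly henselian local base is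
  taken in the local ring itself (which agrees with the strict henselisation there), and
  alignment over a general base is defined via base change to arbitrary strictly
  henselian Noetherian local test rings (which is equivalent to the definition via
  geometric points, since the strict henselisations are among such test rings).
* Excellence of the base is beyond current Mathlib and is omitted from hypotheses.
-/

open AlgebraicGeometry CategoryTheory CategoryTheory.Limits

universe u

noncomputable section

namespace NeronSemistable

/-! ### Local properties of morphisms of schemes -/

/-- `f` is smooth at the point `x` if it is smooth on an open neighbourhood of `x`. -/
def SmoothAtPt {X S : Scheme.{u}} (f : X ⟶ S) (x : X) : Prop :=
  ∃ U : X.Opens, x ∈ U ∧ IsSmooth (U.ι ≫ f)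

/-- `f` is étale at the point `x` if it is étale on an open neighbourhood of `x`. -/
def EtaleAtPt {X S : Scheme.{u}} (f : X ⟶ S) (x : X) : Prop :=
  ∃ U : X.Opens, x ∈ U ∧ IsEtale (U.ι ≫ f)

/-- `f` is flat at `x` if the induced map of stalks is flat. -/
def FlatAtPt {X S : Scheme.{u}} (f : X ⟶ S) (x : X) : Prop :=
  letI := (f.stalkMap x).hom.toAlgebra
  Module.Flat (S.presheaf.stalk (f.base x)) (X.presheaf.stalk x)

/-- A morphism of schemes is flat if it is flat at every point. -/
def SchemeFlat {X S : Scheme.{u}} (f : X ⟶ S) : Prop := ∀ x : X, FlatAtPt f x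

/-- The non-smooth locus of a morphism, as a set of points. -/
def NonSmoothLocus {X S : Scheme.{u}} (f : X ⟶ S) : Set X := {x | ¬ SmoothAtPt f x}

/-! ### Fibres -/

/-- The scheme-theoretic fibre `X_s` of `f : X ⟶ S` over `s ∈ S`. -/
def fiberScheme {X S : Scheme.{u}} (f : X ⟶ S) (s : S) : Scheme.{u} :=
  pullback f (S.fromSpecResidueField s)

/-- The projection from the fibre `X_s` to `X`. -/
def fiberι {X S : Scheme.{u}} (f : X ⟶ S) (s : S) : fiberScheme f s ⟶ X :=
  pullback.fst f (S.fromSpecResidueField s)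

/-- The structure morphism of the fibre `X_s` to the spectrum of the residue field. -/
def fiberRes {X S : Scheme.{u}} (f : X ⟶ S) (s : S) :
    fiberScheme f s ⟶ Spec (S.residueField s) :=
  pullback.snd f (S.fromSpecResidueField s)

/-- `f : X ⟶ S` has geometrically connected fibres. -/
def GeomConnFibers {X S : Scheme.{u}} (f : X ⟶ S) : Prop :=
  ∀ (K : Type u) [Field K] [IsAlgClosed K] (g : Spec (CommRingCat.of K) ⟶ S),
    ConnectedSpace ↑(pullback f g)

/-- A subset `T` of a scheme `Z` over (the spectrum of) a field object `k` is geometrically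
irreducible if its preimage in `Z ×_k K` is irreducible for every field extension `K` of `k`. -/
def GeomIrreducibleOver (k : CommRingCat.{u}) {Z : Scheme.{u}} (g : Z ⟶ Spec k)
    (T : Set Z) : Prop :=
  ∀ (K : Type u) [Field K] (ψ : k ⟶ CommRingCat.of K),
    IsIrreducible ((pullback.fst g (Spec.map ψ)).base ⁻¹' T)

/-! ### Standard local models `Spec R[x₁,…,xₙ]/(x₁⋯x_l − b)` and semistable morphisms -/

open MvPolynomial in
/-- The ring `R[x₁,…,xₙ]/(x₁⋯x_l − b)`. -/
abbrev stdRing (R : Type u) [CommRing R] (n l : ℕ) (b : R) : Type u :=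
  MvPolynomial (Fin n) R ⧸
    Ideal.span {(∏ i : Fin n, if (i : ℕ) < l then X i else 1) - C b}

/-- The standard local model as a scheme. -/
def stdScheme (R : Type u) [CommRing R] (n l : ℕ) (b : R) : Scheme.{u} :=
  Spec (CommRingCat.of (stdRing R n l b))

/-- The structure morphism of the standard local model. -/
def stdSpec (R : CommRingCat.{u}) (n l : ℕ) (b : R) : stdScheme ↥R n l b ⟶ Spec R :=
  Spec.map (CommRingCat.ofHom (algebraMap ↥R (stdRing ↥R n l b)))

open MvPolynomial in
/-- The class of the coordinate `x_i` in the standard model. -/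
def stdCoord (R : Type u) [CommRing R] (n l : ℕ) (b : R) (i : Fin n) : stdRing R n l b :=
  Ideal.Quotient.mk _ (X i)

/-- The data of a commutative diagram exhibiting `f` étale-locally at `x` as a standard
semistable model `Spec R[x₁,…,xₙ]/(x₁⋯x_l − b)`, as in the definition of a semistable
morphism. -/
structure ChartData {X S : Scheme.{u}} (f : X ⟶ S) (x : X) where
  R : CommRingCat.{u}
  n : ℕ
  l : ℕ
  hln : l ≤ n
  b : ↥R
  etS : Spec R ⟶ S
  etS_etale : IsEtale etS
  s' : ↑(Spec R)
  hs' : etS.base s' = f.base x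
  U : Scheme.{u}
  U_conn : ConnectedSpace ↑U
  gX : U ⟶ X
  gX_etale : IsEtale gX
  x' : ↑U
  hx' : gX.base x' = x
  gT : U ⟶ stdScheme ↥R n l b
  gT_etale : IsEtale gT
  comm : gT ≫ stdSpec R n l b ≫ etS = gX ≫ f

/-- A morphism is semistable if it is proper with geometrically connected fibres and admits
standard semistable charts étale-locally at every point. -/
def IsSemistable {X S : Scheme.{u}} (f : X ⟶ S) : Prop :=
  IsProper f ∧ GeomConnFibers f ∧ ∀ x : X, Nonempty (ChartData f x)

/-! ### Local rings: regularity, strict henselianity -/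

/-- The closed point of `Spec R` for a local ring `R` (with the local-ring witness passed
explicitly). -/
def closedPt (R : CommRingCat.{u}) (h : IsLocalRing ↥R) : ↑(Spec R) :=
  (@IsLocalRing.closedPoint ↥R _ h : PrimeSpectrum ↥R)

/-- A commutative ring is strictly henselian local if it is a henselian local ring with
separably closed residue field. -/
structure StrictlyHenselianLocal (A : Type u) [CommRing A] : Prop where
  toIsLocalRing : IsLocalRing A
  henselian : HenselianLocalRing A
  sepClosedResidue : @IsSepClosed (@IsLocalRing.ResidueField A _ toIsLocalRing)
      (@IsLocalRing.ResidueField.field A _ toIsLocalRing)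

/-- A Noetherian local ring is regular if its maximal ideal is generated by
`dim R` many elements. -/
def IsRegularLocal (A : Type u) [CommRing A] : Prop :=
  IsNoetherianRing A ∧ ∃ (h : IsLocalRing A) (s : Finset A),
    Ideal.span (s : Set A) = @IsLocalRing.maximalIdeal A _ h ∧
    (s.card : WithBot (WithTop ℕ)) = ringKrullDim A

/-- A scheme is regular if all its local rings are regular (and it is locally Noetherian). -/
def IsRegularScheme (X : Scheme.{u}) : Prop :=
  IsLocallyNoetherian X ∧ ∀ x : X, IsRegularLocal ↥(X.presheaf.stalk x)

/-! ### Labels of points of semistable morphisms over a local base -/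

/-- Over an affine base `Spec R`, the point `x` (of the non-smooth locus of its fibre) has
label `(b)`, `b ∈ R`, if there is a local chart
`U ⟶ Spec R[x₁,…,xₙ]/(x₁⋯x_l − b)` at `x` (with the coordinates `x₁,…,x_l` contained in
the prime ideal of the image of `x`).  Over a strictly henselian local ring this agrees
with the usual label in the strict henselisation. -/
def HasLabel {R : CommRingCat.{u}} {X : Scheme.{u}} (f : X ⟶ Spec R) (x : X) (b : ↥R) :
    Prop :=
  ∃ (n l : ℕ), l ≤ n ∧
    ∃ (U : Scheme.{u}) (gX : U ⟶ X) (x' : ↑U) (gT : U ⟶ stdScheme ↥R n l b),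
      IsEtale gX ∧ IsEtale gT ∧ gX.base x' = x ∧
      gT ≫ stdSpec R n l b = gX ≫ f ∧
      ∀ i : Fin n, (i : ℕ) < l → stdCoord ↥R n l b i ∈ (gT.base x').asIdeal

/-! ### Reduced closed subschemes and strata of fibres -/

/-- A realisation of the closed subset `C ⊆ X` as a reduced closed subscheme of `X`
(such a realisation always exists and is unique up to unique isomorphism). -/
structure ReducedClosedSubscheme (X : Scheme.{u}) (C : Set X) where
  Z : Scheme.{u}
  ι : Z ⟶ X
  isClosedImmersion : IsClosedImmersion ι
  reduced : IsReduced Z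
  range : Set.range ι.base = C

/-- `Sing` is the sequence of iterated non-smooth loci of a scheme `Z` over a field object
`k`: `Sing 0 = Z`, and `Sing (r+1)` is the non-smooth locus over `k` of `Sing r` endowed
with its reduced induced closed subscheme structure. -/
def IsSingSeq {k : CommRingCat.{u}} {Z : Scheme.{u}} (g : Z ⟶ Spec k)
    (Sing : ℕ → Set Z) : Prop :=
  Sing 0 = Set.univ ∧
  ∀ r : ℕ, ∃ W : ReducedClosedSubscheme Z (Sing r),
    Sing (r + 1) = W.ι.base '' {z | ¬ SmoothAtPt (W.ι ≫ g) z}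

/-- `T` is an `r`-stratum of the scheme `Z` over the field object `k`: an irreducible
component of the smooth locus of the `r`-th iterated non-smooth locus of `Z` over `k`. -/
def IsStratum {k : CommRingCat.{u}} {Z : Scheme.{u}} (g : Z ⟶ Spec k) (r : ℕ)
    (T : Set Z) : Prop :=
  ∃ Sing : ℕ → Set Z, IsSingSeq g Sing ∧
    ∃ W : ReducedClosedSubscheme Z (Sing r),
      ∃ T' ∈ irreducibleComponents {z : W.Z // SmoothAtPt (W.ι ≫ g) z},
        T = W.ι.base '' (Subtype.val '' T')

/-! ### Dual graphs, cycles and alignment over a local base -/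

/-- The (1-)stratum `T` of the closed fibre of `f` has label `b` (i.e. some — equivalently,
by constancy of labels, any — point of it has label `b`). -/
def StratumHasLabel {R : CommRingCat.{u}} {X : Scheme.{u}} (f : X ⟶ Spec R)
    (s : ↑(Spec R)) (T : Set (fiberScheme f s)) (b : ↥R) : Prop :=
  ∃ z ∈ T, HasLabel f ((fiberι f s).base z) b

/-- A cycle in the dual graph of the fibre of `f : X ⟶ Spec R` over the point `s`:
a cyclic sequence of pairwise distinct vertices (irreducible components of the fibre)
joined by pairwise distinct edges (1-strata, each contained in exactly the two
neighbouring components). -/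
structure GraphCycle {R : CommRingCat.{u}} {X : Scheme.{u}} (f : X ⟶ Spec R)
    (s : ↑(Spec R)) where
  N : ℕ
  hN : 0 < N
  v : Fin N → Set (fiberScheme f s)
  hv : ∀ i, v i ∈ irreducibleComponents ↑(fiberScheme f s)
  v_inj : Function.Injective v
  T : Fin N → Set (fiberScheme f s)
  hT : ∀ i, IsStratum (fiberRes f s) 1 (T i)
  T_inj : Function.Injective T
  incident : ∀ i : Fin N,
    {c ∈ irreducibleComponents ↑(fiberScheme f s) | T i ⊆ c} =
      {v i, v (⟨((i : ℕ) + 1) % N, Nat.mod_lt _ hN⟩ : Fin N)}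

/-- `f : X ⟶ Spec R` (for `R` local) is aligned at the closed point: for any cycle in the
dual graph of the closed fibre, the labels of any two of its edges admit equal positive
powers (as ideals of `R`). -/
def AlignedOver {R : CommRingCat.{u}} (hR : IsLocalRing ↥R) {X : Scheme.{u}}
    (f : X ⟶ Spec R) : Prop :=
  ∀ (c : GraphCycle f (closedPt R hR)) (i j : Fin c.N) (bi bj : ↥R),
    StratumHasLabel f (closedPt R hR) (c.T i) bi →
    StratumHasLabel f (closedPt R hR) (c.T j) bj →
    ∃ n m : ℕ, 0 < n ∧ 0 < m ∧ Ideal.span {bi} ^ n = Ideal.span {bj} ^ m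

/-- `f : X ⟶ S` is aligned (at every geometric point): the base change of `f` to any
Noetherian strictly henselian local test ring over `S` is aligned at the closed point.
(Taking the test ring to be a strict henselisation of a local ring of `S` recovers the
notion of alignment at a geometric point of `S`.) -/
def IsAligned {X S : Scheme.{u}} (f : X ⟶ S) : Prop :=
  ∀ (A : CommRingCat.{u}), IsNoetherianRing ↥A →
    ∀ (h : StrictlyHenselianLocal ↥A) (g : Spec A ⟶ S),
      AlignedOver h.toIsLocalRing (pullback.snd f g)

/-! ### The specialisation relation on irreducible components of fibres -/

/-- The irreducible component `Z` of the fibre `X_s` specialises (under `sp_{s→η}`) to the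
irreducible component `Y` of `X_η`, i.e. `Z` is contained in the fibre over `s` of the
closure of `Y` in `X`. -/
def spRel {X S : Scheme.{u}} (f : X ⟶ S) (s η : S)
    (Z : Set (fiberScheme f s)) (Y : Set (fiberScheme f η)) : Prop :=
  (fiberι f s).base '' Z ⊆ closure ((fiberι f η).base '' Y)

/-- `C` is a connected component of the subset `A` of a topological space. -/
def IsConnCompOf {α : Type u} [TopologicalSpace α] (A C : Set α) : Prop :=
  ∃ x : ↥A, C = Subtype.val '' connectedComponent x
/-! ### Orders of vanishing, Weil divisors and Cartier divisors -/

/-- `a` has order (length of `A/(a)` as an `A`-module, computed as the Krull dimension of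
the lattice of submodules) equal to `m`. -/
def elemOrd (A : Type u) [CommRing A] (a : A) (m : ℕ) : Prop :=
  Order.krullDim (Submodule A (A ⧸ Ideal.span {a})) = (m : ℕ∞)

/-- The order of vanishing of `a ∈ R` at the point `p` of `Spec R` is `k`. -/
def IsLocOrd {R : Type u} [CommRing R] (a : R) (p : PrimeSpectrum R) (k : ℕ) : Prop :=
  elemOrd (Localization (@Ideal.primeCompl R _ p.asIdeal p.2))
    (algebraMap R (Localization (@Ideal.primeCompl R _ p.asIdeal p.2)) a) k

/-- `z` is a divisorial point of `X`: its local ring has Krull dimension 1, i.e. the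
closure of `z` is a prime divisor on `X`. -/
def IsDivisorialPt (X : Scheme.{u}) (z : X) : Prop :=
  ringKrullDim ↥(X.presheaf.stalk z) = 1

/-- The order of vanishing at `z ∈ V` of the section `h ∈ Γ(X, V)` is `m`. -/
def germOrd {X : Scheme.{u}} (V : X.Opens) (h : Γ(X, V)) (z : X) (hz : z ∈ V)
    (m : ℕ) : Prop :=
  elemOrd ↥(X.presheaf.stalk z) (X.presheaf.germ V z hz h) m

/-- A Weil divisor on `X` is recorded as a coefficient function on points of `X`; only its
values at divisorial points are relevant. `CutsOn D V h₁ h₂` says that on the open set `V`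
the divisor `D` is cut out by the pair of nonzerodivisors `(h₁, h₂)` (i.e. `D` equals
`div h₁ − div h₂` on `V`). -/
def CutsOn {X : Scheme.{u}} (D : X → ℤ) (V : X.Opens) (h₁ h₂ : Γ(X, V)) : Prop :=
  h₁ ∈ nonZeroDivisors Γ(X, V) ∧ h₂ ∈ nonZeroDivisors Γ(X, V) ∧
  ∀ z (hz : z ∈ V), IsDivisorialPt X z →
    ∀ m₁ m₂ : ℕ, germOrd V h₁ z hz m₁ → germOrd V h₂ z hz m₂ →
      D z = (m₁ : ℤ) - (m₂ : ℤ)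

/-- The Weil divisor `D` is a Cartier divisor: it is cut out locally by ratios of
nonzerodivisor sections. -/
def IsCartierDiv {X : Scheme.{u}} (D : X → ℤ) : Prop :=
  ∀ x : X, ∃ V : X.Opens, x ∈ V ∧ ∃ h₁ h₂ : Γ(X, V), CutsOn D V h₁ h₂

/-- `D'` is the pullback along `p : W ⟶ X` of the Cartier divisor `D` on `X`: at every
divisorial point of `W`, the coefficient of `D'` is computed by pulling back local
equations of `D`. -/
def IsDivPullback {W X : Scheme.{u}} (p : W ⟶ X) (D : X → ℤ) (D' : W → ℤ) : Prop :=
  ∀ w : W, IsDivisorialPt W w →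
    ∀ (V : X.Opens) (hw : p.base w ∈ V) (h₁ h₂ : Γ(X, V)), CutsOn D V h₁ h₂ →
      ∀ m₁ m₂ : ℕ, germOrd (p ⁻¹ᵁ V) (p.app V h₁) w hw m₁ →
        germOrd (p ⁻¹ᵁ V) (p.app V h₂) w hw m₂ →
          D' w = (m₁ : ℤ) - (m₂ : ℤ)

/-- Two Weil divisors on `X` are linearly equivalent if their difference is the divisor of
a global ratio of nonzerodivisor sections. -/
def LinEquivDiv {X : Scheme.{u}} (D D' : X → ℤ) : Prop :=
  ∃ h₁ h₂ : Γ(X, ⊤), h₁ ∈ nonZeroDivisors Γ(X, ⊤) ∧ h₂ ∈ nonZeroDivisors Γ(X, ⊤) ∧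
    ∀ z : X, IsDivisorialPt X z →
      ∀ m₁ m₂ : ℕ, germOrd ⊤ h₁ z trivial m₁ → germOrd ⊤ h₂ z trivial m₂ →
        D z - D' z = (m₁ : ℤ) - (m₂ : ℤ)

/-! ### Group schemes over a base (group objects via generalized points) -/

/-- A group scheme over `S`: a scheme `G/S` together with multiplication, unit and
inverse morphisms satisfying the group axioms (expressed on generalized points). -/
structure GroupSchemeOver (S : Scheme.{u}) where
  G : Scheme.{u}
  π : G ⟶ S
  e : S ⟶ G
  e_sec : e ≫ π = 𝟙 S
  mul : pullback π π ⟶ G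
  mul_over : mul ≫ π = pullback.fst π π ≫ π
  inv : G ⟶ G
  inv_over : inv ≫ π = π
  mul_assoc' : ∀ {T : Scheme.{u}} (a b c : T ⟶ G) (hab : a ≫ π = b ≫ π)
    (hbc : b ≫ π = c ≫ π)
    (h₁ : (pullback.lift a b hab ≫ mul) ≫ π = c ≫ π)
    (h₂ : a ≫ π = (pullback.lift b c hbc ≫ mul) ≫ π),
    pullback.lift (pullback.lift a b hab ≫ mul) c h₁ ≫ mul =
      pullback.lift a (pullback.lift b c hbc ≫ mul) h₂ ≫ mul
  one_mul' : ∀ {T : Scheme.{u}} (a : T ⟶ G) (h : (a ≫ π ≫ e) ≫ π = a ≫ π),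
    pullback.lift (a ≫ π ≫ e) a h ≫ mul = a
  mul_one' : ∀ {T : Scheme.{u}} (a : T ⟶ G) (h : a ≫ π = (a ≫ π ≫ e) ≫ π),
    pullback.lift a (a ≫ π ≫ e) h ≫ mul = a
  inv_mul' : ∀ {T : Scheme.{u}} (a : T ⟶ G) (h : (a ≫ inv) ≫ π = a ≫ π),
    pullback.lift (a ≫ inv) a h ≫ mul = a ≫ π ≫ e
/-! ### Line bundles via Čech gluing data, and the relative Picard scheme -/

/-- A line bundle on a scheme `Y`, presented by Čech gluing data: an open cover together
with unit transition functions satisfying the cocycle condition. -/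
structure GluingData (Y : Scheme.{u}) where
  I : Type u
  U : I → Y.Opens
  covers : iSup U = ⊤
  t : ∀ i j : I, Γ(Y, U i ⊓ U j)
  t_isUnit : ∀ i j, IsUnit (t i j)
  cocycle : ∀ i j k : I,
    (Y.presheaf.map (homOfLE (inf_le_left : (U i ⊓ U j) ⊓ U k ≤ U i ⊓ U j)).op) (t i j) *
    (Y.presheaf.map (homOfLE (le_inf (inf_le_left.trans inf_le_right)
      (inf_le_right : (U i ⊓ U j) ⊓ U k ≤ U k))).op) (t j k) =
    (Y.presheaf.map (homOfLE (le_inf (inf_le_left.trans inf_le_left)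
      (inf_le_right : (U i ⊓ U j) ⊓ U k ≤ U k))).op) (t i k)

/-- The trivial line bundle. -/
def trivialGluing (Y : Scheme.{u}) : GluingData Y where
  I := PUnit
  U := fun _ => ⊤
  covers := by simp
  t := fun _ _ => 1
  t_isUnit := fun _ _ => isUnit_one
  cocycle := by intro i j k; simp

/-- `D'` is the pullback of the gluing data `D` along `φ : Z ⟶ Y`. -/
def IsPullbackGluing {Z Y : Scheme.{u}} (φ : Z ⟶ Y) (D : GluingData Y)
    (D' : GluingData Z) : Prop :=
  ∃ eqv : D.I ≃ D'.I,
    (∀ i, D'.U (eqv i) = φ ⁻¹ᵁ D.U i) ∧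
    ∀ (i j : D.I) (hle : D'.U (eqv i) ⊓ D'.U (eqv j) ≤ φ ⁻¹ᵁ (D.U i ⊓ D.U j)),
      D'.t (eqv i) (eqv j) =
        (Z.presheaf.map (homOfLE hle).op) ((φ.app (D.U i ⊓ D.U j)) (D.t i j))

/-- Two gluing data on `Y` present isomorphic line bundles: on a common refinement their
transition functions differ by a coboundary. -/
def GluingIso {Y : Scheme.{u}} (D₁ D₂ : GluingData Y) : Prop :=
  ∃ (K : Type u) (W : K → Y.Opens) (_ : iSup W = ⊤)
    (r₁ : K → D₁.I) (r₂ : K → D₂.I)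
    (_ : ∀ k, W k ≤ D₁.U (r₁ k)) (_ : ∀ k, W k ≤ D₂.U (r₂ k))
    (s : ∀ k, Γ(Y, W k)),
    (∀ k, IsUnit (s k)) ∧
    ∀ (k k' : K) (hle₁ : W k ⊓ W k' ≤ D₁.U (r₁ k) ⊓ D₁.U (r₁ k'))
      (hle₂ : W k ⊓ W k' ≤ D₂.U (r₂ k) ⊓ D₂.U (r₂ k')),
      (Y.presheaf.map (homOfLE hle₁).op) (D₁.t (r₁ k) (r₁ k')) *
        (Y.presheaf.map (homOfLE (inf_le_right : W k ⊓ W k' ≤ W k')).op) (s k') =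
      (Y.presheaf.map (homOfLE (inf_le_left : W k ⊓ W k' ≤ W k)).op) (s k) *
        (Y.presheaf.map (homOfLE hle₂).op) (D₂.t (r₂ k) (r₂ k'))

/-- `D₃` is (isomorphic to) the tensor product of the line bundles presented by `D₁` and
`D₂`: on a common refinement, its transition functions are the products of those of `D₁`
and `D₂`, up to a coboundary. -/
def TensorIso {Y : Scheme.{u}} (D₁ D₂ D₃ : GluingData Y) : Prop :=
  ∃ (K : Type u) (W : K → Y.Opens) (_ : iSup W = ⊤)
    (r₁ : K → D₁.I) (r₂ : K → D₂.I) (r₃ : K → D₃.I)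
    (_ : ∀ k, W k ≤ D₁.U (r₁ k)) (_ : ∀ k, W k ≤ D₂.U (r₂ k))
    (_ : ∀ k, W k ≤ D₃.U (r₃ k)) (s : ∀ k, Γ(Y, W k)),
    (∀ k, IsUnit (s k)) ∧
    ∀ (k k' : K) (hle₁ : W k ⊓ W k' ≤ D₁.U (r₁ k) ⊓ D₁.U (r₁ k'))
      (hle₂ : W k ⊓ W k' ≤ D₂.U (r₂ k) ⊓ D₂.U (r₂ k'))
      (hle₃ : W k ⊓ W k' ≤ D₃.U (r₃ k) ⊓ D₃.U (r₃ k')),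
      (Y.presheaf.map (homOfLE hle₃).op) (D₃.t (r₃ k) (r₃ k')) *
        (Y.presheaf.map (homOfLE (inf_le_right : W k ⊓ W k' ≤ W k')).op) (s k') =
      (Y.presheaf.map (homOfLE (inf_le_left : W k ⊓ W k' ≤ W k)).op) (s k) *
        ((Y.presheaf.map (homOfLE hle₁).op) (D₁.t (r₁ k) (r₁ k')) *
          (Y.presheaf.map (homOfLE hle₂).op) (D₂.t (r₂ k) (r₂ k')))

/-- An fppf cover: faithfully flat and locally of finite presentation. -/
def IsFppfCover {T' T : Scheme.{u}} (c : T' ⟶ T) : Prop :=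
  SchemeFlat c ∧ LocallyOfFinitePresentation c ∧ Function.Surjective c.base

/-- For `g : T ⟶ S` and `c : T' ⟶ T`, the induced morphism `X ×_S T' ⟶ X ×_S T`. -/
def inducedMap {X S T T' : Scheme.{u}} (f : X ⟶ S) (g : T ⟶ S) (c : T' ⟶ T) :
    pullback f (c ≫ g) ⟶ pullback f g :=
  pullback.map f (c ≫ g) f g (𝟙 X) c (𝟙 S) (by simp) (by simp)

/-- Data exhibiting a group scheme `P/S` as (a scheme representing) the relative Picard
functor `Pic_{X/S}`, i.e. the fppf sheafification of `T ↦ Pic(X ×_S T)`: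
a natural assignment `toPic` from line bundles on `X ×_S T` to `T`-points of `P`, which is
compatible with pullback, isomorphism and tensor products, sends the trivial bundle to the
unit section, and is fppf-locally bijective. -/
structure PicardData {X S : Scheme.{u}} (f : X ⟶ S) extends GroupSchemeOver S where
  lfp : LocallyOfFinitePresentation π
  toPic : ∀ {T : Scheme.{u}} (g : T ⟶ S), GluingData (pullback f g) → (T ⟶ G)
  toPic_over : ∀ {T : Scheme.{u}} (g : T ⟶ S) (D : GluingData (pullback f g)),
    toPic g D ≫ π = g
  toPic_trivial : ∀ {T : Scheme.{u}} (g : T ⟶ S),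
    toPic g (trivialGluing _) = g ≫ e
  toPic_pullback : ∀ {T T' : Scheme.{u}} (g : T ⟶ S) (c : T' ⟶ T)
    (D : GluingData (pullback f g)) (D' : GluingData (pullback f (c ≫ g))),
    IsPullbackGluing (inducedMap f g c) D D' → toPic (c ≫ g) D' = c ≫ toPic g D
  toPic_iso : ∀ {T : Scheme.{u}} (g : T ⟶ S) (D₁ D₂ : GluingData (pullback f g)),
    GluingIso D₁ D₂ → toPic g D₁ = toPic g D₂
  toPic_mul : ∀ {T : Scheme.{u}} (g : T ⟶ S) (D₁ D₂ D₃ : GluingData (pullback f g))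
    (_ : TensorIso D₁ D₂ D₃)
    (h : toPic g D₁ ≫ π = toPic g D₂ ≫ π),
    pullback.lift (toPic g D₁) (toPic g D₂) h ≫ mul = toPic g D₃
  locally_surjective : ∀ {T : Scheme.{u}} (g : T ⟶ S) (h : T ⟶ G), h ≫ π = g →
    ∃ (T' : Scheme.{u}) (c : T' ⟶ T), IsFppfCover c ∧
      ∃ D' : GluingData (pullback f (c ≫ g)), toPic (c ≫ g) D' = c ≫ h
  locally_injective : ∀ {T : Scheme.{u}} (g : T ⟶ S)
    (D₁ D₂ : GluingData (pullback f g)), toPic g D₁ = toPic g D₂ →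
    ∃ (T' : Scheme.{u}) (c : T' ⟶ T), IsFppfCover c ∧
      ∃ (D₁' D₂' : GluingData (pullback f (c ≫ g))) (E : GluingData T')
        (E' E₂ : GluingData (pullback f (c ≫ g))),
        IsPullbackGluing (inducedMap f g c) D₁ D₁' ∧
        IsPullbackGluing (inducedMap f g c) D₂ D₂' ∧
        IsPullbackGluing (pullback.snd f (c ≫ g)) E E' ∧
        TensorIso D₁' E' E₂ ∧ GluingIso E₂ D₂'

/-! ### `Pic⁰`, scheme-theoretic closures and Néron models -/

/-- The fibrewise identity component of a group scheme `P/S` over the open set `U ⊆ S`: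
the set of points lying over `U` and belonging to the connected component of the unit
section inside their fibre. -/
def pic0Set {S : Scheme.{u}} (P : GroupSchemeOver S) (U : S.Opens) : Set P.G :=
  {p | P.π.base p ∈ U ∧
    p ∈ connectedComponentIn (P.π.base ⁻¹' {P.π.base p}) (P.e.base (P.π.base p))}

/-- `(Z, ι)` is the scheme-theoretic closure (scheme-theoretic image) of `g : A ⟶ P`:
the smallest closed subscheme of `P` through which `g` factors. -/
structure IsSchClosure {A P : Scheme.{u}} (g : A ⟶ P) (Z : Scheme.{u}) (ι : Z ⟶ P) :
    Prop where
  isClosedImmersion : IsClosedImmersion ι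
  factors : ∃ g' : A ⟶ Z, g' ≫ ι = g
  smallest : ∀ (W : Scheme.{u}) (κ : W ⟶ P), IsClosedImmersion κ →
    (∃ w : A ⟶ W, w ≫ κ = g) → ∃ ρ : Z ⟶ W, ρ ≫ κ = ι

/-- A Néron model over `S` of a smooth "abelian" scheme `A` over the dense open `U ⊆ S`:
a smooth separated scheme `N/S` with an isomorphism `N ×_S U ≅ A` over `U`, satisfying
the Néron mapping property.  (The paper allows `N` to be an algebraic space; algebraic
spaces are not available in Mathlib, so schemes are used.) -/
structure NeronModelData {S : Scheme.{u}} (U : S.Opens) {A : Scheme.{u}}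
    (aU : A ⟶ U.toScheme) where
  N : Scheme.{u}
  ν : N ⟶ S
  smooth : IsSmooth ν
  separated : IsSeparated ν
  isoU : (ν ⁻¹ᵁ U).toScheme ≅ A
  isoU_over : isoU.hom ≫ aU = ν ∣_ U
  mapping : ∀ (T : Scheme.{u}) (t : T ⟶ S), IsSmooth t →
    ∀ (φU : (t ⁻¹ᵁ U).toScheme ⟶ A), φU ≫ aU = t ∣_ U →
      ∃! φ : T ⟶ N, φ ≫ ν = t ∧
        (t ⁻¹ᵁ U).ι ≫ φ = φU ≫ isoU.inv ≫ (ν ⁻¹ᵁ U).ι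

/-! ### Projective morphisms -/

attribute [local instance] MvPolynomial.gradedAlgebra

/-- Projective `n`-space (over `Spec (ULift ℤ)`). -/
def projSpace (n : ℕ) : Scheme.{u} :=
  Proj (MvPolynomial.homogeneousSubmodule (Fin (n + 1)) (ULift.{u} ℤ))

/-- Relative projective `n`-space over `S`. -/
def projSpaceOver (S : Scheme.{u}) (n : ℕ) : Scheme.{u} :=
  pullback (terminal.from (projSpace.{u} n)) (terminal.from S)

/-- A morphism is projective if it factors as a closed immersion into some relative
projective space over the base. -/
def IsProjectiveMorphism {X S : Scheme.{u}} (f : X ⟶ S) : Prop :=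
  ∃ (n : ℕ) (ι : X ⟶ projSpaceOver S n),
    IsClosedImmersion ι ∧ ι ≫ pullback.snd _ _ = f
end NeronSemistable
end

noncomputable section
namespace NeronSemistable

/-! ### Tensor products of fields over a separably closed field -/

section Helpers

open scoped TensorProduct

/-- A nonzero finite type algebra over an algebraically closed field has a rational point. -/
lemma exists_algHom_of_finiteType (k A : Type*) [Field k] [IsAlgClosed k] [CommRing A]
    [Nontrivial A] [Algebra k A] [Algebra.FiniteType k A] : Nonempty (A →ₐ[k] k) := by
  obtain ⟨m, hm⟩ := Ideal.exists_maximal A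
  let := Ideal.Quotient.field m
  have : Module.Finite k (A ⧸ m) := finite_of_finite_type_of_isJacobsonRing k (A ⧸ m)
  have hb : Function.Bijective (algebraMap k (A ⧸ m)) :=
    IsAlgClosed.algebraMap_bijective_of_isIntegral
  exact ⟨((AlgEquiv.ofBijective (Algebra.ofId k (A ⧸ m)) hb).symm : (A ⧸ m) →ₐ[k] k).comp
    (Ideal.Quotient.mkₐ k m)⟩

lemma repr_map_id {k A B L ι : Type*} [Field k] [CommRing A] [CommRing B] [CommRing L]
    [Algebra k A] [Algebra k B] [Algebra k L] (b : Module.Basis ι k L) (φ : A →ₐ[k] B)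
    (z : A ⊗[k] L) (i : ι) :
    (b.baseChange B).repr (Algebra.TensorProduct.map φ (AlgHom.id k L) z) i =
      φ ((b.baseChange A).repr z i) := by
  induction z with
  | zero => simp
  | tmul a l => simp [Module.Basis.baseChange_repr_tmul]
  | add x y hx hy => simp [hx, hy]

/-- The tensor product of two fields over an algebraically closed field is a domain. -/
lemma isDomain_tensor_of_isAlgClosed (k K L : Type*) [Field k] [IsAlgClosed k] [Field K]
    [Field L] [Algebra k K] [Algebra k L] : IsDomain (K ⊗[k] L) := by
  classical
  have : NoZeroDivisors (K ⊗[k] L) := by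
    refine ⟨fun {x y} hxy => ?_⟩
    by_contra! h
    let b := Module.Basis.ofVectorSpace k L
    obtain ⟨i, hi⟩ : ∃ i, (b.baseChange K).repr x i ≠ 0 := by
      by_contra! h'
      exact h.1 ((b.baseChange K).repr.injective (by ext i; simpa using h' i))
    obtain ⟨j, hj⟩ : ∃ j, (b.baseChange K).repr y j ≠ 0 := by
      by_contra! h'
      exact h.2 ((b.baseChange K).repr.injective (by ext i; simpa using h' i))
    set a := (b.baseChange K).repr x i with ha
    set c := (b.baseChange K).repr y j with hc
    let s : Finset K := ((b.baseChange K).repr x).support.image ((b.baseChange K).repr x) ∪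
      ((b.baseChange K).repr y).support.image ((b.baseChange K).repr y) ∪ {a⁻¹, c⁻¹}
    let A := Algebra.adjoin k (s : Set K)
    have hsA : ∀ z ∈ s, z ∈ A := fun z hz => Algebra.subset_adjoin hz
    have : Algebra.FiniteType k A := A.fg_iff_finiteType.mp ⟨s, rfl⟩
    obtain ⟨φ⟩ := exists_algHom_of_finiteType k A
    let ι := Algebra.TensorProduct.map A.val (AlgHom.id k L)
    have hι : Function.Injective ι :=
      Module.Flat.rTensor_preserves_injective_linearMap A.val.toLinearMap Subtype.val_injective
    have lift : ∀ z : K ⊗[k] L, (∀ i, (b.baseChange K).repr z i ∈ A) → ∃ z', ι z' = z := by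
      intro z hz
      change z ∈ ι.range
      rw [← (b.baseChange K).linearCombination_repr z, Finsupp.linearCombination_apply]
      refine Subalgebra.sum_mem _ fun i _ => ⟨⟨_, hz i⟩ ⊗ₜ b i, ?_⟩
      simp [ι, TensorProduct.smul_tmul']
    obtain ⟨x', hxx⟩ := lift x fun i => by
      by_cases h0 : (b.baseChange K).repr x i = 0
      · rw [h0]; exact A.zero_mem
      · exact hsA _ (Finset.mem_union_left _ (Finset.mem_union_left _
          (Finset.mem_image_of_mem _ (Finsupp.mem_support_iff.mpr h0))))
    obtain ⟨y', hyy⟩ := lift y fun i => by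
      by_cases h0 : (b.baseChange K).repr y i = 0
      · rw [h0]; exact A.zero_mem
      · exact hsA _ (Finset.mem_union_left _ (Finset.mem_union_right _
          (Finset.mem_image_of_mem _ (Finsupp.mem_support_iff.mpr h0))))
    have hxy' : x' * y' = 0 := hι (by rw [map_mul, hxx, hyy, hxy, map_zero])
    let ψ := Algebra.TensorProduct.map φ (AlgHom.id k L)
    have key : ∀ (z : A ⊗[k] L) (w : K ⊗[k] L) (i), ι z = w → (b.baseChange K).repr w i ≠ 0 →
        ((b.baseChange K).repr w i)⁻¹ ∈ A → ψ z ≠ 0 := by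
      rintro z _ i rfl hz hmem h0
      have h1 : φ ((b.baseChange A).repr z i) = 0 := by
        rw [← repr_map_id b φ z i]
        change (b.baseChange k).repr (ψ z) i = 0
        rw [h0]; simp
      have h2 : (b.baseChange A).repr z i * ⟨_, hmem⟩ = 1 := by
        apply Subtype.ext
        have h3 : (((b.baseChange A).repr z i : A) : K) = (b.baseChange K).repr (ι z) i :=
          (repr_map_id b A.val z i).symm
        simp only [MulMemClass.coe_mul, h3, OneMemClass.coe_one]
        exact mul_inv_cancel₀ hz
      have := congrArg φ h2
      rw [map_mul, h1, zero_mul, map_one] at this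
      exact zero_ne_one this
    have hx' : ψ x' ≠ 0 := key x' x i hxx hi (hsA _ (by simp [s, ← ha]))
    have hy' : ψ y' ≠ 0 := key y' y j hyy hj (hsA _ (by simp [s, ← hc]))
    let e := Algebra.TensorProduct.lid k L
    have h4 : e (ψ x') * e (ψ y') = 0 := by rw [← map_mul, ← map_mul, hxy', map_zero, map_zero]
    rcases mul_eq_zero.mp h4 with h | h
    · exact hx' (e.injective (by rw [h, map_zero]))
    · exact hy' (e.injective (by rw [h, map_zero]))
  have : Nontrivial (K ⊗[k] L) := inferInstance
  exact NoZeroDivisors.to_isDomain _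

/-- Auxiliary form: if `K` and `L` contain a common algebraically closed, purely inseparable
extension `E` of `k`, then the nilradical of `K ⊗[k] L` is prime. -/
lemma nilradical_isPrime_aux (k E K L : Type*) [Field k] [Field E] [IsAlgClosed E] [Field K]
    [Field L] [Algebra k E] [IsPurelyInseparable k E] [Algebra k K] [Algebra k L]
    [Algebra E K] [Algebra E L] [IsScalarTower k E K] [IsScalarTower k E L] :
    (nilradical (K ⊗[k] L)).IsPrime := by
  have := isDomain_tensor_of_isAlgClosed E K L
  let N := nilradical (K ⊗[k] L)
  let Q := (K ⊗[k] L) ⧸ N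
  let inl : K →ₐ[k] Q := (Ideal.Quotient.mkₐ k N).comp Algebra.TensorProduct.includeLeft
  let inr : L →ₐ[k] Q := (Ideal.Quotient.mkₐ k N).comp Algebra.TensorProduct.includeRight
  have hcomp : ∀ e : E, inr (algebraMap E L e) = inl (algebraMap E K e) := by
    intro e
    change Ideal.Quotient.mk N _ = Ideal.Quotient.mk N _
    rw [Ideal.Quotient.eq, mem_nilradical]
    obtain ⟨n, a, ha⟩ := IsPurelyInseparable.pow_mem k (ringExpChar k) e
    have : ExpChar (K ⊗[k] L) (ringExpChar k) :=
      expChar_of_injective_algebraMap (algebraMap k (K ⊗[k] L)).injective _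
    refine ⟨ringExpChar k ^ n, ?_⟩
    rw [sub_pow_expChar_pow, ← map_pow, ← map_pow, ← map_pow, ← map_pow, ← ha,
      ← IsScalarTower.algebraMap_apply, ← IsScalarTower.algebraMap_apply, sub_eq_zero]
    exact (Algebra.TensorProduct.tmul_one_eq_one_tmul (A := K) (B := L) a).symm
  let inl' : K →ₐ[E] Q := { inl with commutes' := fun _ => rfl }
  let inr' : L →ₐ[E] Q := { inr with commutes' := hcomp }
  let π : K ⊗[k] L →+* K ⊗[E] L :=
    (Algebra.TensorProduct.mapOfCompatibleSMul E k k K L).toRingHom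
  let ρ : K ⊗[E] L →ₐ[E] Q := Algebra.TensorProduct.lift inl' inr' fun _ _ => mul_comm _ _
  have hρ : ∀ z, ρ (π z) = Ideal.Quotient.mk N z := by
    intro z
    induction z with
    | zero => simp
    | tmul a l =>
      change ρ (a ⊗ₜ l) = _
      refine (Algebra.TensorProduct.lift_tmul inl' inr' (fun _ _ => mul_comm _ _) a l).trans ?_
      change Ideal.Quotient.mk N (a ⊗ₜ 1) * Ideal.Quotient.mk N (1 ⊗ₜ l) = _
      rw [← map_mul, Algebra.TensorProduct.tmul_mul_tmul, mul_one, one_mul]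
    | add x y hx hy => simp only [map_add, hx, hy]
  have hker : nilradical (K ⊗[k] L) = RingHom.ker π := by
    apply le_antisymm
    · intro z hz
      exact ((mem_nilradical.mp hz).map π).eq_zero
    · intro z hz
      rw [← Ideal.Quotient.eq_zero_iff_mem (I := nilradical (K ⊗[k] L))]
      have := hρ z
      rw [RingHom.mem_ker.mp hz, map_zero] at this
      exact this.symm
  rw [hker]
  exact RingHom.ker_isPrime π

lemma nilradical_tensor_isPrime (k K L : Type*) [Field k] [IsSepClosed k] [Field K]
    [Field L] [Algebra k K] [Algebra k L] : (nilradical (K ⊗[k] L)).IsPrime := by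
  let E := AlgebraicClosure k
  let K' := AlgebraicClosure K
  let L' := AlgebraicClosure L
  let iK : E →ₐ[k] K' := IsAlgClosed.lift
  let iL : E →ₐ[k] L' := IsAlgClosed.lift
  let : Algebra E K' := iK.toRingHom.toAlgebra
  let : Algebra E L' := iL.toRingHom.toAlgebra
  have : IsScalarTower k E K' := .of_algebraMap_eq fun x => (iK.commutes x).symm
  have : IsScalarTower k E L' := .of_algebraMap_eq fun x => (iL.commutes x).symm
  have hp := nilradical_isPrime_aux k E K' L'
  let j : K ⊗[k] L →ₐ[k] K' ⊗[k] L' :=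
    Algebra.TensorProduct.map (IsScalarTower.toAlgHom k K K') (IsScalarTower.toAlgHom k L L')
  have hj : Function.Injective j :=
    TensorProduct.map_injective_of_flat_flat (IsScalarTower.toAlgHom k K K').toLinearMap
      (IsScalarTower.toAlgHom k L L').toLinearMap
      (algebraMap K K').injective (algebraMap L L').injective
  have : nilradical (K ⊗[k] L) = (nilradical (K' ⊗[k] L')).comap j := by
    ext z
    rw [Ideal.mem_comap, mem_nilradical, mem_nilradical, IsNilpotent.map_iff hj]
  rw [this]
  exact hp.comap j

/-- Any field extension of a separably closed field is geometrically irreducible. -/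
lemma geometricallyIrreducible_of_isSepClosed (k K : Type u) [Field k] [IsSepClosed k] [Field K]
    (ψ : CommRingCat.of k ⟶ CommRingCat.of K) : GeometricallyIrreducible (Spec.map ψ) := by
  let : Algebra k K := ψ.hom.toAlgebra
  refine ⟨geometrically_iff_of_commRing_of_isClosedUnderIsomorphisms.mpr fun L _ _ => ?_⟩
  let : Algebra k L := ‹_›
  have h : IrreducibleSpace (PrimeSpectrum (K ⊗[k] L)) :=
    PrimeSpectrum.irreducibleSpace_iff_isPrime_nilradical.mpr (nilradical_tensor_isPrime k K L)
  exact (pullbackSpecIso k K L).hom.homeomorph.irreducibleSpace_iff.mpr h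

end Helpers

/-- Lemma 2.7 of the paper.  Let `k` be a separably closed field and
`f : X ⟶ Spec k` a semistable morphism.  Then every element of the `r`-strata of `X` is
geometrically irreducible. -/
theorem strata_geometrically_irreducible
    (k : Type u) [Field k] [IsSepClosed k] {X : Scheme.{u}}
    (f : X ⟶ Spec (CommRingCat.of k)) (hss : IsSemistable f)
    (r : ℕ) (T : Set X) (hT : IsStratum f r T) :
    GeomIrreducibleOver (CommRingCat.of k) f T := by
  intro K _ ψ
  obtain ⟨Sing, -, W, T', hT', rfl⟩ := hT
  have hirr : IsIrreducible (W.ι.base '' (Subtype.val '' T')) :=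
    (hT'.1.image _ continuous_subtype_val.continuousOn).image _ W.ι.continuous.continuousOn
  have := geometricallyIrreducible_of_isSepClosed k K ψ
  have : GeometricallyIrreducible (pullback.fst f (Spec.map ψ)) :=
    inferInstance
  have : IsIntegral (Spec (CommRingCat.of k)) := inferInstance
  have : Subsingleton (Spec (CommRingCat.of k)) :=
    inferInstanceAs (Subsingleton (PrimeSpectrum k))
  exact (pullback.fst f (Spec.map ψ)).isIrreducible_preimage
    (pullback.fst f (Spec.map ψ)).isOpenMap hirr

end NeronSemistable
end
end

section
/- Let f: X → S be a proper, flat morphism with reduced fibres, where S is a locally Noetherian integral scheme with generic point η, and assume the fibres of f are pure dimensional. Let Y be an irreducible component of X_η and Ȳ its scheme-theoretic closure in X. Then for every point s ∈ S, the fibre Ȳ_s is a union of irreducible components of X_s; moreover, every irreducible component Z of X_s is contained in Ȳ_s for some irreducible component Y of X_η. -/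
/-!
Common infrastructure for formalizing "Néron models of jacobians over base schemes of
dimension greater than 1" (semistable morphisms, strata, dual graphs, alignment,
specialisation maps, Cartier/Weil divisors, Picard data, Néron models).

Notes on design choices (Mathlib has no algebraic spaces, no Picard functor, no strict
henselisation and no excellent rings):
* Algebraic spaces are replaced by schemes throughout.
* The label of a point of a semistable morphism over a strictly henselian local base is
  taken in the local ring itself (which agrees with the strict henselisation there), and
  alignment over a general base is defined via base change to arbitrary strictly
  henselian Noetherian local test rings (which is equivalent to the definition via
  geometric points, since the strict henselisations are among such test rings).
* Excellence of the base is beyond current Mathlib and is omitted from hypotheses.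
-/

open AlgebraicGeometry CategoryTheory CategoryTheory.Limits

universe u

noncomputable section

namespace NeronSemistable

/-! ### Projective morphisms -/

attribute [local instance] MvPolynomial.gradedAlgebra

end NeronSemistable
end

noncomputable section
namespace NeronSemistable


/-- `t` is algebraically independent in `B/Q` over `A/(Q ∩ A)`. -/
def RelIndep (A : Type u) {B : Type u} [CommRing A] [CommRing B] [Algebra A B] (Q : Ideal B)
    {ι : Type u} (t : ι → B) : Prop :=
  ∀ F : MvPolynomial ι A, MvPolynomial.aeval t F ∈ Q → ∀ m, algebraMap A B (F.coeff m) ∈ Q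

section alg
variable {A B : Type u} [CommRing A] [CommRing B] [Algebra A B]

lemma aeval_mk_map (p : Ideal A) (Q : Ideal B) [Q.LiesOver p] {ι : Type u} (t : ι → B)
    (F : MvPolynomial ι A) :
    MvPolynomial.aeval (Ideal.Quotient.mk Q ∘ t) (MvPolynomial.map (Ideal.Quotient.mk p) F) =
      Ideal.Quotient.mk Q (MvPolynomial.aeval t F) := by
  induction F using MvPolynomial.induction_on with
  | C a => simp [← Ideal.Quotient.algebraMap_eq, ← IsScalarTower.algebraMap_apply]
  | add p q hp hq => simp [hp, hq]
  | mul_X p n hp => simp [hp]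

lemma mem_iff_of_liesOver (p : Ideal A) (Q : Ideal B) [Q.LiesOver p] (a : A) :
    algebraMap A B a ∈ Q ↔ a ∈ p := by
  rw [Ideal.over_def Q p, Ideal.mem_comap]

lemma relIndep_iff (p : Ideal A) (Q : Ideal B) [Q.LiesOver p] {ι : Type u} (t : ι → B) :
    RelIndep A Q t ↔ AlgebraicIndependent (A ⧸ p) (Ideal.Quotient.mk Q ∘ t) := by
  rw [algebraicIndependent_iff]
  constructor
  · intro h G hG
    obtain ⟨F, rfl⟩ := MvPolynomial.map_surjective _ Ideal.Quotient.mk_surjective G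
    rw [aeval_mk_map, Ideal.Quotient.eq_zero_iff_mem] at hG
    ext m
    rw [MvPolynomial.coeff_map, MvPolynomial.coeff_zero, Ideal.Quotient.eq_zero_iff_mem,
      ← mem_iff_of_liesOver p Q]
    exact h F hG m
  · intro h F hF m
    have := h (MvPolynomial.map (Ideal.Quotient.mk p) F)
      (by rw [aeval_mk_map, Ideal.Quotient.eq_zero_iff_mem]; exact hF)
    rw [mem_iff_of_liesOver p Q, ← Ideal.Quotient.eq_zero_iff_mem, ← MvPolynomial.coeff_map, this,
      MvPolynomial.coeff_zero]

lemma relIndep_drop (Q' Q : Ideal B) [Q'.IsPrime] [Q.IsPrime] (hlt : Q' < Q)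
    (hu : Q'.under A = Q.under A) {ι : Type u} (t : ι → B) (ht : RelIndep A Q t) :
    ∃ t' : Option ι → B, RelIndep A Q' t' := by
  obtain ⟨h, hQ, hQ'⟩ := Set.exists_of_ssubset hlt
  have key : ∀ F : MvPolynomial ι A, MvPolynomial.aeval t F ∈ Q → ∀ m,
      algebraMap A B (F.coeff m) ∈ Q' := by
    intro F hF m
    have := ht F hF m
    rwa [← Ideal.mem_comap, ← Ideal.under_def, hu, Ideal.under_def, Ideal.mem_comap]
  have h1 : RelIndep A Q' t := fun F hF m => key F (hlt.le hF) m
  refine ⟨fun o => o.elim h t, ?_⟩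
  have h2 := (relIndep_iff (Q'.under A) Q' t).1 h1
  rw [relIndep_iff (Q'.under A) Q']
  have : (Ideal.Quotient.mk Q' ∘ fun o : Option ι => o.elim h t) =
      fun o : Option ι => o.elim (Ideal.Quotient.mk Q' h) (Ideal.Quotient.mk Q' ∘ t) := by
    ext o; cases o <;> rfl
  rw [this, h2.option_iff_transcendental]
  intro halg
  have hne : Ideal.Quotient.mk Q' h ≠ 0 := by
    rwa [Ne, Ideal.Quotient.eq_zero_iff_mem]
  obtain ⟨⟨r, hr⟩, hr0, hdvd⟩ := halg.exists_nonzero_dvd (mem_nonZeroDivisors_of_ne_zero hne)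
  apply hr0
  rw [Algebra.adjoin_range_eq_range_aeval] at hr
  obtain ⟨G, rfl⟩ := hr
  obtain ⟨F, rfl⟩ := MvPolynomial.map_surjective _ Ideal.Quotient.mk_surjective G
  obtain ⟨c, hc⟩ := hdvd
  obtain ⟨c, rfl⟩ := Ideal.Quotient.mk_surjective c
  replace hc : MvPolynomial.aeval (Ideal.Quotient.mk Q' ∘ t)
    (MvPolynomial.map (Ideal.Quotient.mk (Q'.under A)) F) = _ := hc
  ext
  change MvPolynomial.aeval (Ideal.Quotient.mk Q' ∘ t)
    (MvPolynomial.map (Ideal.Quotient.mk (Q'.under A)) F) = 0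
  have h3 : MvPolynomial.map (Ideal.Quotient.mk (Q'.under A)) F = 0 := by
    ext m
    rw [MvPolynomial.coeff_map, MvPolynomial.coeff_zero, Ideal.Quotient.eq_zero_iff_mem,
      ← mem_iff_of_liesOver (Q'.under A) Q']
    refine key F ?_ m
    rw [aeval_mk_map, ← map_mul, Ideal.Quotient.eq] at hc
    have := Q.add_mem (hlt.le hc) (Q.mul_mem_right c hQ)
    simpa using this
  rw [h3, map_zero]

/-- Relative transcendence degree -/
def relTd (A : Type u) {B : Type u} [CommRing A] [CommRing B] [Algebra A B] (Q : Ideal B) :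
    Cardinal.{u} := Algebra.trdeg (A ⧸ Q.under A) (B ⧸ Q)

lemma RelIndep.card_le (Q : Ideal B) [Q.IsPrime] {ι : Type u} (t : ι → B) (ht : RelIndep A Q t) :
    Cardinal.mk ι ≤ relTd A Q :=
  ((relIndep_iff (Q.under A) Q t).1 ht).cardinalMk_le_trdeg

lemma exists_relIndep (Q : Ideal B) [Q.IsPrime] :
    ∃ (ι : Type u) (t : ι → B), RelIndep A Q t ∧ Cardinal.mk ι = relTd A Q ∧
      Algebra.IsAlgebraic (Algebra.adjoin (A ⧸ Q.under A) (Set.range (Ideal.Quotient.mk Q ∘ t)))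
        (B ⧸ Q) := by
  obtain ⟨s, hs⟩ := exists_isTranscendenceBasis (A ⧸ Q.under A) (B ⧸ Q)
  refine ⟨s, fun i => Quotient.out i.1, ?_⟩
  have h : (Ideal.Quotient.mk Q ∘ fun i : s => Quotient.out i.1) = Subtype.val := by
    ext i; exact Ideal.Quotient.mk_out _
  rw [relIndep_iff (Q.under A), h]
  exact ⟨hs.1, hs.cardinalMk_eq_trdeg, hs.isAlgebraic⟩

lemma relTd_drop (Q' Q : Ideal B) [Q'.IsPrime] [Q.IsPrime] (hlt : Q' < Q)
    (hu : Q'.under A = Q.under A) : relTd A Q + 1 ≤ relTd A Q' := by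
  obtain ⟨ι, t, ht, hc, -⟩ := exists_relIndep (A := A) Q
  obtain ⟨t', ht'⟩ := relIndep_drop Q' Q hlt hu t ht
  have := ht'.card_le
  rwa [Cardinal.mk_option, hc] at this

lemma relTd_lt_aleph0 [Algebra.FiniteType A B] (Q : Ideal B) [Q.IsPrime] :
    relTd A Q < Cardinal.aleph0 := by
  have : Algebra.FiniteType A (B ⧸ Q) := .trans ‹_› inferInstance
  have : Algebra.FiniteType (A ⧸ Q.under A) (B ⧸ Q) := .of_restrictScalars_finiteType A _ _
  exact trdeg_lt_aleph0_of_finiteType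

end alg
section alg2

/-- Isolated points in fibres and the main theorem of Zariski. -/
lemma isAlgebraic_of_isolated {S C : Type u} [CommRing S] [CommRing C] [IsDomain C] [Algebra S C]
    [Algebra.FiniteType S C] (hinj : Function.Injective (algebraMap S C))
    (q : Ideal C) [q.IsPrime]
    (hmin : ∀ r : Ideal C, r.IsPrime → r ≤ q → r.under S = q.under S → r = q)
    (hmax : ∀ r : Ideal C, r.IsPrime → q ≤ r → r.under S = q.under S → r = q) :
    Algebra.IsAlgebraic S C := by
  let x : PrimeSpectrum C := ⟨q, inferInstance⟩
  let p := x.comap (algebraMap S C)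
  have hqf : Algebra.QuasiFiniteAt S x.asIdeal := by
    apply Algebra.QuasiFiniteAt.of_isOpen_singleton_fiber
    let e := PrimeSpectrum.preimageHomeomorphFiber S C p
    let eo := PrimeSpectrum.preimageOrderIsoFiber S C p
    have : IsNoetherianRing (p.asIdeal.Fiber C) :=
      Algebra.FiniteType.isNoetherianRing p.asIdeal.ResidueField _
    have : IsJacobsonRing (p.asIdeal.Fiber C) :=
      isJacobsonRing_of_finiteType (A := p.asIdeal.ResidueField)
    have hopen : IsOpen {e ⟨x, rfl⟩} := by
      rw [(PrimeSpectrum.isOpen_singleton_tfae_of_isNoetherian_of_isJacobsonRing _).out 0 2 rfl rfl]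
      constructor
      · rw [PrimeSpectrum.isClosed_singleton_iff_isMaximal, ← PrimeSpectrum.isMax_iff]
        intro y hy
        obtain ⟨z, rfl⟩ := eo.surjective y
        replace hy : (⟨x, rfl⟩ : PrimeSpectrum.comap (algebraMap S C) ⁻¹' {p}) ≤ z :=
          eo.le_iff_le.1 hy
        have : z.1.asIdeal = q := hmax _ z.1.2 hy (congrArg PrimeSpectrum.asIdeal z.2)
        have : z = ⟨x, rfl⟩ := Subtype.ext (PrimeSpectrum.ext this)
        rw [this]
        exact le_rfl
      · rintro a b hab rfl
        obtain ⟨z, rfl⟩ := eo.surjective b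
        rw [← PrimeSpectrum.le_iff_specializes] at hab
        replace hy : z ≤ (⟨x, rfl⟩ : PrimeSpectrum.comap (algebraMap S C) ⁻¹' {p}) :=
          eo.le_iff_le.1 hab
        have : z.1.asIdeal = q := hmin _ z.1.2 hy (congrArg PrimeSpectrum.asIdeal z.2)
        have : z = ⟨x, rfl⟩ := Subtype.ext (PrimeSpectrum.ext this)
        rw [this]
        rfl
    have := hopen.preimage e.continuous
    convert this
    ext
    exact e.injective.eq_iff.symm
  have hqf' : Algebra.QuasiFiniteAt S (⊥ : Ideal C) := by
    have : Algebra.QuasiFiniteAt S q := hqf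
    exact Algebra.QuasiFiniteAt.of_le (Q := q) bot_le
  have hS : IsDomain S := hinj.isDomain
  let K := FractionRing S
  let L := Localization.AtPrime (⊥ : Ideal C)
  have hCL : Function.Injective (algebraMap C L) :=
    IsLocalization.injective (M := (⊥ : Ideal C).primeCompl) _ (by
      intro x hx; exact mem_nonZeroDivisors_of_ne_zero hx)
  have hL : IsDomain L := IsLocalization.isDomain_of_le_nonZeroDivisors (M := (⊥ : Ideal C).primeCompl) _ (by
      intro x hx; exact mem_nonZeroDivisors_of_ne_zero hx)
  have : IsFractionRing C L := by
    have : (⊥ : Ideal C).primeCompl = nonZeroDivisors C := by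
      ext x; simp [Ideal.primeCompl]
    unfold IsFractionRing
    rw [← this]
    infer_instance
  let : Field L := IsFractionRing.toField C
  have hSL : Function.Injective (algebraMap S L) := by
    rw [IsScalarTower.algebraMap_eq S C L]; exact hCL.comp hinj
  have : FaithfulSMul S L := (faithfulSMul_iff_algebraMap_injective S L).2 hSL
  let : Algebra K L := FractionRing.liftAlgebra S L
  have : IsScalarTower S K L := FractionRing.isScalarTower_liftAlgebra S L
  have : Algebra.QuasiFinite S L := hqf'
  have : Algebra.QuasiFinite K L := .of_restrictScalars S K L
  have : Module.Finite K L := .of_quasiFinite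
  have : Algebra.IsAlgebraic K L := inferInstance
  have : Algebra.IsAlgebraic S L := (IsFractionRing.comap_isAlgebraic_iff (A := S) (K := K) (C := L)).2 this
  constructor
  intro c
  exact (isAlgebraic_algebraMap_iff hCL).1 (this.isAlgebraic (algebraMap C L c))

variable {A B : Type u} [CommRing A] [CommRing B] [Algebra A B]

lemma relTd_le_of_isolated [Algebra.FiniteType A B] (P Q : Ideal B) [P.IsPrime] [Q.IsPrime]
    (hPQ : P ≤ Q) (hmin : ∀ r : Ideal B, r.IsPrime → P ≤ r → r ≤ Q → r.under A = Q.under A → r = Q) :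
    relTd A P ≤ relTd A Q := by
  obtain ⟨ι, t, ht, hc, halg⟩ := exists_relIndep (A := A) Q
  rw [← hc]
  let A' := A ⧸ P.under A
  let C := B ⧸ P
  let s : Set C := Set.range (Ideal.Quotient.mk P ∘ t)
  have hF : Algebra.FiniteType A C := .trans ‹_› inferInstance
  have hF' : Algebra.FiniteType A' C := .of_restrictScalars_finiteType A _ _
  let S := Algebra.adjoin A' s
  have hF'' : Algebra.FiniteType S C := .of_restrictScalars_finiteType A' _ _
  have hsurj : Function.Surjective (Ideal.Quotient.mk P) := Ideal.Quotient.mk_surjective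
  have hker : RingHom.ker (Ideal.Quotient.mk P) = P := Ideal.mk_ker
  let q : Ideal C := Q.map (Ideal.Quotient.mk P)
  have hq : q.IsPrime := Ideal.map_isPrime_of_surjective hsurj (by rwa [hker])
  have hqc : q.comap (Ideal.Quotient.mk P) = Q := by
    rw [Ideal.comap_map_of_surjective' _ hsurj, hker, sup_eq_left.2 hPQ]
  have hmemS : ∀ F : MvPolynomial ι A, Ideal.Quotient.mk P (MvPolynomial.aeval t F) ∈ S := by
    intro F
    rw [← aeval_mk_map (P.under A)]
    simp only [S, s, Algebra.adjoin_range_eq_range_aeval]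
    exact ⟨_, rfl⟩
  have huS : ∀ r : Ideal C, r.under S = q.under S → ∀ F : MvPolynomial ι A,
      MvPolynomial.aeval t F ∈ r.comap (Ideal.Quotient.mk P) ↔ MvPolynomial.aeval t F ∈ Q := by
    intro r hr F
    have h1 : Ideal.Quotient.mk P (MvPolynomial.aeval t F) ∈ r ↔
        Ideal.Quotient.mk P (MvPolynomial.aeval t F) ∈ q :=
      (congrArg (fun T => (⟨_, hmemS F⟩ : S) ∈ T) hr).to_iff
    have h2 : MvPolynomial.aeval t F ∈ Q ↔ Ideal.Quotient.mk P (MvPolynomial.aeval t F) ∈ q := by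
      conv_lhs => rw [← hqc]
      exact Iff.rfl
    rw [h2, ← h1, Ideal.mem_comap]
  have : Algebra.IsAlgebraic S C := by
    refine isAlgebraic_of_isolated Subtype.val_injective q ?_ ?_
    · intro r hr hrq hru
      apply Ideal.comap_injective_of_surjective _ hsurj
      rw [hqc]
      apply hmin _ inferInstance
      · exact hker.symm.le.trans (Ideal.ker_le_comap _)
      · exact (Ideal.comap_mono hrq).trans hqc.le
      · ext a
        simpa using huS r hru (MvPolynomial.C a)
    · intro r hr hrq hru
      apply Ideal.comap_injective_of_surjective _ hsurj
      rw [hqc]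
      have hle : Q ≤ r.comap (Ideal.Quotient.mk P) := by
        exact hqc.symm.le.trans (Ideal.comap_mono hrq)
      refine le_antisymm ?_ hle
      intro x hx
      by_contra hxQ
      have hne : Ideal.Quotient.mk Q x ≠ 0 := by
        rwa [Ne, Ideal.Quotient.eq_zero_iff_mem]
      obtain ⟨⟨y, hy⟩, hy0, hdvd⟩ := (halg.isAlgebraic (Ideal.Quotient.mk Q x)).exists_nonzero_dvd
        (mem_nonZeroDivisors_of_ne_zero hne)
      apply hy0
      rw [Algebra.adjoin_range_eq_range_aeval] at hy
      obtain ⟨G, rfl⟩ := hy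
      obtain ⟨F, rfl⟩ := MvPolynomial.map_surjective _ Ideal.Quotient.mk_surjective G
      obtain ⟨c, hc⟩ := hdvd
      obtain ⟨c, rfl⟩ := Ideal.Quotient.mk_surjective c
      replace hc : MvPolynomial.aeval (Ideal.Quotient.mk Q ∘ t)
        (MvPolynomial.map (Ideal.Quotient.mk (Q.under A)) F) = _ := hc
      ext
      change MvPolynomial.aeval (Ideal.Quotient.mk Q ∘ t)
        (MvPolynomial.map (Ideal.Quotient.mk (Q.under A)) F) = 0
      rw [aeval_mk_map, ← map_mul, Ideal.Quotient.eq] at hc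
      rw [aeval_mk_map, Ideal.Quotient.eq_zero_iff_mem, ← huS r hru]
      have := Ideal.add_mem _ (hle hc) (Ideal.mul_mem_right c _ hx)
      simpa using this
  refine (Algebra.IsAlgebraic.trdeg_le_cardinalMk A' s).trans ?_
  exact Cardinal.mk_range_le

end alg2
section alg3

lemma algebraicIndependent_iff_monomials {R M : Type u} [CommRing R] [CommRing M] [Algebra R M]
    {ι : Type u} (t : ι → M) : AlgebraicIndependent R t ↔
      LinearIndependent R (fun m : ι →₀ ℕ => MvPolynomial.aeval (R := R) t (MvPolynomial.monomial m 1)) := by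
  constructor
  · intro h
    have h1 := (MvPolynomial.basisMonomials ι R).linearIndependent.map'
      (MvPolynomial.aeval (R := R) t).toLinearMap (LinearMap.ker_eq_bot.2 h)
    have e : (fun m : ι →₀ ℕ => MvPolynomial.aeval (R := R) t (MvPolynomial.monomial m 1)) =
        (MvPolynomial.aeval (R := R) t).toLinearMap ∘ MvPolynomial.basisMonomials ι R := by
      ext m
      simp
    rw [e]
    exact h1
  · intro h
    rw [algebraicIndependent_iff]
    intro F hF
    rw [linearIndependent_iff'] at h
    have hs : ∑ m ∈ F.support, F.coeff m • MvPolynomial.aeval (R := R) t (MvPolynomial.monomial m 1) = 0 := by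
      rw [← hF]
      conv_rhs => rw [F.as_sum, map_sum]
      refine Finset.sum_congr rfl fun m _ => ?_
      rw [← map_smul, MvPolynomial.smul_monomial, smul_eq_mul, mul_one]
    have := h _ _ hs
    ext m
    by_cases hm : m ∈ F.support
    · simpa using this m hm
    · simpa using hm

lemma algebraicIndependent_of_flat {R L : Type u} [CommRing R] [CommRing L] [Algebra R L]
    [IsLocalRing R] [IsLocalRing L] [IsLocalHom (algebraMap R L)] [Module.Flat R L]
    {ι : Type u} (t : ι → L)
    (h : AlgebraicIndependent (IsLocalRing.ResidueField R) (IsLocalRing.residue L ∘ t)) :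
    AlgebraicIndependent R t := by
  rw [algebraicIndependent_iff_monomials] at h ⊢
  apply Module.IsLocalRing.linearIndependent_of_flat
  let φ : TensorProduct R (IsLocalRing.ResidueField R) L →ₐ[IsLocalRing.ResidueField R]
      IsLocalRing.ResidueField L :=
    Algebra.TensorProduct.lift (Algebra.ofId _ _) (IsScalarTower.toAlgHom R L _)
      (fun _ _ => .all _ _)
  refine LinearIndependent.of_comp φ.toLinearMap ?_
  refine (congrArg (fun v => LinearIndependent (IsLocalRing.ResidueField R) v) ?_).mp h
  ext m
  simp [φ, MvPolynomial.aeval_monomial, Finsupp.prod]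

variable {A B : Type u} [CommRing A] [CommRing B] [Algebra A B]

lemma exists_lift_of_flat [IsDomain A] [Module.Flat A B] (Q : Ideal B) [Q.IsPrime]
    {ι : Type u} (t : ι → B) (ht : RelIndep A Q t) :
    ∃ P : Ideal B, P.IsPrime ∧ P.under A = ⊥ ∧ RelIndep A P t := by
  let p := Q.under A
  let _ := Localization.AtPrime.algebraOfLiesOver p Q
  let R := Localization.AtPrime p
  let L := Localization.AtPrime Q
  rw [relIndep_iff p Q] at ht
  let _ : Algebra (A ⧸ p) Q.ResidueField :=
    ((algebraMap (B ⧸ Q) Q.ResidueField).comp (algebraMap (A ⧸ p) (B ⧸ Q))).toAlgebra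
  have _ : IsScalarTower (A ⧸ p) (B ⧸ Q) Q.ResidueField := .of_algebraMap_eq' rfl
  have _ : IsScalarTower (A ⧸ p) p.ResidueField Q.ResidueField := by
    refine .of_algebraMap_eq fun x ↦ ?_
    obtain ⟨x, rfl⟩ := Ideal.Quotient.mk_surjective x
    have e1 : algebraMap (A ⧸ p) Q.ResidueField (Ideal.Quotient.mk p x) =
      algebraMap B Q.ResidueField (algebraMap A B x) := rfl
    rw [e1, Ideal.algebraMap_quotient_residueField_mk, ← IsScalarTower.algebraMap_apply,
      ← IsScalarTower.algebraMap_apply]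
  have h1 : AlgebraicIndependent (A ⧸ p)
      (fun i => algebraMap B Q.ResidueField (t i)) :=
    ht.map' (f := IsScalarTower.toAlgHom (A ⧸ p) (B ⧸ Q) Q.ResidueField)
      Q.injective_algebraMap_quotient_residueField
  have h2 : AlgebraicIndependent p.ResidueField
      (fun i => algebraMap B Q.ResidueField (t i)) := by
    rw [algebraicIndependent_iff_monomials] at h1 ⊢
    rw [LinearIndependent.iff_fractionRing (R := A ⧸ p) (K := p.ResidueField)] at h1
    refine (congrArg (fun v => LinearIndependent p.ResidueField v) ?_).mp h1
    ext m
    simp [MvPolynomial.aeval_monomial]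
  have h3 := algebraicIndependent_of_flat (R := R) (L := L) (algebraMap B L ∘ t) h2
  have h4 : AlgebraicIndependent A (algebraMap B L ∘ t) := by
    refine h3.restrictScalars (K := R) ?_
    exact IsLocalization.injective R p.primeCompl_le_nonZeroDivisors
  obtain ⟨P', hP', hc⟩ := Ideal.exists_comap_eq_of_mem_minimalPrimes_of_injective
    (f := (MvPolynomial.aeval (R := A) (algebraMap B L ∘ t)).toRingHom) h4 ⊥
    (by rw [IsDomain.minimalPrimes_eq_singleton_bot]; rfl)
  have key : ∀ F : MvPolynomial ι A, MvPolynomial.aeval t F ∈ P'.comap (algebraMap B L) → F = 0 := by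
    intro F hF
    rw [← Ideal.mem_bot, ← hc, Ideal.mem_comap]
    rw [Ideal.mem_comap] at hF
    convert hF
    exact (MvPolynomial.comp_aeval_apply t (IsScalarTower.toAlgHom A B L) F).symm
  refine ⟨P'.comap (algebraMap B L), inferInstance, ?_, ?_⟩
  · rw [eq_bot_iff]
    intro a ha
    have := key (MvPolynomial.C a) (by rw [MvPolynomial.aeval_C]; exact ha)
    simpa using this
  · intro F hF m
    rw [key F hF]
    simp

end alg3
section alg4

lemma le_ringKrullDim_of_le_trdeg {K C : Type u} [Field K] [CommRing C] [IsDomain C] [Algebra K C]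
    [Algebra.FiniteType K C] (n : ℕ) (hn : (n : Cardinal) ≤ Algebra.trdeg K C) :
    (n : WithBot ℕ∞) ≤ Order.krullDim (PrimeSpectrum C) := by
  obtain ⟨s, g, hg, hi⟩ := exists_integral_inj_algHom_of_fg K C
  let _ : Algebra (MvPolynomial (Fin s) K) C := g.toRingHom.toAlgebra
  have _ : IsScalarTower K (MvPolynomial (Fin s) K) C := .of_algebraMap_eq' g.comp_algebraMap.symm
  have hInt : Algebra.IsIntegral (MvPolynomial (Fin s) K) C := ⟨hi⟩
  have hf : FaithfulSMul (MvPolynomial (Fin s) K) C :=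
    (faithfulSMul_iff_algebraMap_injective _ _).2 hg
  have h1 := trdeg_add_eq K (MvPolynomial (Fin s) K) (A := C)
  rw [trdeg_eq_zero (R := MvPolynomial (Fin s) K), add_zero, MvPolynomial.trdeg_of_isDomain] at h1
  have hns : n ≤ s := by
    rw [← h1] at hn
    simpa using hn
  have h2 : ((s : ℕ) : WithBot ℕ∞) ≤ Order.krullDim (PrimeSpectrum (MvPolynomial (Fin s) K)) := by
    have := MvPolynomial.ringKrullDim_of_isNoetherianRing (R := K) (ι := Fin s)
    rw [ringKrullDim] at this
    rw [this]
    simp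
  obtain ⟨l, hl⟩ := Order.le_krullDim_iff.1 h2
  obtain ⟨P, hP, hPl⟩ := Ideal.exists_ideal_over_prime_of_isIntegral_of_isPrime l.head.asIdeal (⊥ : Ideal C)
    (by rw [Ideal.comap_bot_of_injective (algebraMap (MvPolynomial (Fin s) K) C) hg]; exact bot_le)
  have _ : P.LiesOver l.head.asIdeal := ⟨hPl.2.symm⟩
  have := hPl.1
  obtain ⟨L, hL, -⟩ := Ideal.exists_ltSeries_of_hasGoingUp l P
  refine le_trans ?_ (Order.LTSeries.length_le_krullDim L)
  rw [hL, hl]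
  exact_mod_cast hns

variable {A B : Type u} [CommRing A] [CommRing B] [Algebra A B]

lemma le_krullDim_of_le_relTd [IsDomain A] [Algebra.FiniteType A B] (P : Ideal B) [P.IsPrime]
    (hP : P.under A = ⊥) (n : ℕ) (hn : (n : Cardinal) ≤ relTd A P) :
    (n : WithBot ℕ∞) ≤ Order.krullDim
      {r : PrimeSpectrum B // P ≤ r.asIdeal ∧ r.asIdeal.under A = ⊥} := by
  obtain ⟨ι, t, ht, hc, -⟩ := exists_relIndep (A := A) P
  let K := FractionRing A
  let D := B ⧸ P
  have hAD : Function.Injective (algebraMap A D) := by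
    rw [injective_iff_map_eq_zero]
    intro a ha
    rw [← Ideal.mem_bot, ← hP, Ideal.mem_comap]
    exact Ideal.Quotient.eq_zero_iff_mem.1 ha
  let M := Algebra.algebraMapSubmonoid D (nonZeroDivisors A)
  let C := Localization M
  have hM : M ≤ nonZeroDivisors D := by
    rintro _ ⟨a, ha, rfl⟩
    refine mem_nonZeroDivisors_of_ne_zero ?_
    rw [Ne, map_eq_zero_iff _ hAD]
    exact nonZeroDivisors.ne_zero ha
  have hDC : Function.Injective (algebraMap D C) := IsLocalization.injective _ hM
  have hC : IsDomain C := IsLocalization.isDomain_localization hM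
  let _ : Algebra K C := localizationAlgebra (nonZeroDivisors A) D
  have _ : IsScalarTower A K C := isScalarTower_localizationAlgebra _ _
  have hF : Algebra.FiniteType A D := .trans ‹_› inferInstance
  have hFC : Algebra.FiniteType K C :=
    have _ : IsLocalization ((nonZeroDivisors A).map (algebraMap A D)) C :=
      inferInstanceAs (IsLocalization M C)
    RingHom.finiteType_localizationPreserves (algebraMap A D) (nonZeroDivisors A) K C ((RingHom.finiteType_algebraMap).2 hF)
  have hi : AlgebraicIndependent A (fun i => algebraMap B C (t i)) := by
    rw [algebraicIndependent_iff]
    intro F hF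
    have h1 : MvPolynomial.aeval t F ∈ P := by
      rw [← Ideal.Quotient.eq_zero_iff_mem]
      apply hDC
      rw [map_zero, ← hF]
      exact (MvPolynomial.comp_aeval_apply t (IsScalarTower.toAlgHom A B C) F)
    ext m
    rw [MvPolynomial.coeff_zero, ← Ideal.mem_bot, ← hP]
    exact ht F h1 m
  have hiK : AlgebraicIndependent K (fun i => algebraMap B C (t i)) := by
    rw [algebraicIndependent_iff_monomials] at hi ⊢
    rw [LinearIndependent.iff_fractionRing (R := A) (K := K)] at hi
    refine (congrArg (fun v => LinearIndependent K v) ?_).mp hi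
    ext m
    simp [MvPolynomial.aeval_monomial]
  have hn' : (n : Cardinal) ≤ Algebra.trdeg K C := by
    refine hn.trans ?_
    rw [← hc]
    exact hiK.cardinalMk_le_trdeg
  refine (le_ringKrullDim_of_le_trdeg n hn').trans ?_
  refine Order.krullDim_le_of_strictMono (fun q => ⟨(q.comap (algebraMap D C)).comap
    (Ideal.Quotient.mk P), ?_, ?_⟩) ?_
  · intro x hx
    have : Ideal.Quotient.mk P x = 0 := Ideal.Quotient.eq_zero_iff_mem.2 hx
    change algebraMap D C (Ideal.Quotient.mk P x) ∈ q.asIdeal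
    rw [this, map_zero]
    exact zero_mem _
  · rw [eq_bot_iff]
    intro a ha
    replace ha : algebraMap A C a ∈ q.asIdeal := ha
    rw [IsScalarTower.algebraMap_apply A K C] at ha
    by_contra h0
    have h0' : algebraMap A K a ≠ 0 := by
      rw [Ne, map_eq_zero_iff _ (IsFractionRing.injective A K)]
      exact h0
    exact q.2.ne_top (Ideal.eq_top_of_isUnit_mem _ ha (h0'.isUnit.map _))
  · have hmono : Monotone (fun q : PrimeSpectrum C => (q.comap (algebraMap D C)).comap
      (Ideal.Quotient.mk P)) := fun a b hab => Ideal.comap_mono (Ideal.comap_mono hab)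
    have hinj : Function.Injective (fun q : PrimeSpectrum C => (q.comap (algebraMap D C)).comap
      (Ideal.Quotient.mk P)) :=
      (PrimeSpectrum.comap_injective_of_surjective _ Ideal.Quotient.mk_surjective).comp
        (PrimeSpectrum.localization_comap_injective C M)
    exact hmono.strictMono_of_injective hinj

lemma exists_relTd_lt [IsDomain A] [Module.Flat A B] [Algebra.FiniteType A B]
    (P Q Q' : Ideal B) [P.IsPrime] [Q.IsPrime] [Q'.IsPrime] (hPQ : P ≤ Q)
    (hmin : ∀ r : Ideal B, r.IsPrime → P ≤ r → r ≤ Q → r.under A = Q.under A → r = Q)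
    (hlt : Q' < Q) (hu : Q'.under A = Q.under A) :
    ∃ P' : Ideal B, P'.IsPrime ∧ P'.under A = ⊥ ∧ relTd A P + 1 ≤ relTd A P' := by
  obtain ⟨ι, t, ht, hc, -⟩ := exists_relIndep (A := A) Q
  obtain ⟨t', ht'⟩ := relIndep_drop Q' Q hlt hu t ht
  obtain ⟨P', h1, h2, h3⟩ := exists_lift_of_flat Q' t' ht'
  refine ⟨P', h1, h2, ?_⟩
  have := h3.card_le
  rw [Cardinal.mk_option, hc] at this
  refine le_trans ?_ this
  gcongr
  exact relTd_le_of_isolated P Q hPQ hmin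

end alg4

section bridge
lemma trdeg_eq_relTd {A B k l : Type u} [CommRing A] [CommRing B] [Field k] [Field l]
    [Algebra A B] [Algebra k l] (α : A →+* k) (β : B →+* l)
    (hc : ∀ a, β (algebraMap A B a) = algebraMap k l (α a))
    (Q : Ideal B) (hQ : ∀ b, β b = 0 ↔ b ∈ Q)
    (hk : ∀ c : k, ∃ a s, α s ≠ 0 ∧ c * α s = α a)
    (hl : ∀ c : l, ∃ a s, β s ≠ 0 ∧ c * β s = β a) :
    Algebra.trdeg k l = relTd A Q := by
  have hp : ∀ a, α a = 0 ↔ a ∈ Q.under A := by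
    intro a
    rw [Ideal.under_def, Ideal.mem_comap, ← hQ, hc, map_eq_zero (algebraMap k l)]
  let i1 : Algebra (A ⧸ Q.under A) k :=
    (Ideal.Quotient.lift (Q.under A) α (fun a ha => (hp a).2 ha)).toAlgebra
  let i2 : Algebra (B ⧸ Q) l := (Ideal.Quotient.lift Q β (fun a ha => (hQ a).2 ha)).toAlgebra
  let i3 : Algebra (A ⧸ Q.under A) l :=
    ((algebraMap k l).comp (algebraMap (A ⧸ Q.under A) k)).toAlgebra
  have t1 : IsScalarTower (A ⧸ Q.under A) k l := .of_algebraMap_eq fun _ => rfl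
  have e1 : ∀ a : A, algebraMap (A ⧸ Q.under A) k (Ideal.Quotient.mk _ a) = α a := fun a => rfl
  have e2 : ∀ a : B, algebraMap (B ⧸ Q) l (Ideal.Quotient.mk _ a) = β a := fun a => rfl
  have t2 : IsScalarTower (A ⧸ Q.under A) (B ⧸ Q) l := .of_algebraMap_eq fun x => by
    obtain ⟨a, rfl⟩ := Ideal.Quotient.mk_surjective x
    rw [IsScalarTower.algebraMap_apply _ k l, e1, ← hc, ← e2]
    rfl
  have inj1 : Function.Injective (algebraMap (A ⧸ Q.under A) k) := by
    rw [injective_iff_map_eq_zero]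
    intro x hx
    obtain ⟨a, rfl⟩ := Ideal.Quotient.mk_surjective x
    exact Ideal.Quotient.eq_zero_iff_mem.2 ((hp a).1 hx)
  have inj2 : Function.Injective (algebraMap (B ⧸ Q) l) := by
    rw [injective_iff_map_eq_zero]
    intro x hx
    obtain ⟨a, rfl⟩ := Ideal.Quotient.mk_surjective x
    exact Ideal.Quotient.eq_zero_iff_mem.2 ((hQ a).1 hx)
  have d1 : IsDomain (A ⧸ Q.under A) := inj1.isDomain
  have d2 : IsDomain (B ⧸ Q) := inj2.isDomain
  have f1 : FaithfulSMul (A ⧸ Q.under A) k := (faithfulSMul_iff_algebraMap_injective _ _).2 inj1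
  have f2 : FaithfulSMul (B ⧸ Q) l := (faithfulSMul_iff_algebraMap_injective _ _).2 inj2
  have fr1 : IsFractionRing (A ⧸ Q.under A) k := IsFractionRing.of_field _ _ fun c => by
    obtain ⟨a, s, hs, h⟩ := hk c
    exact ⟨Ideal.Quotient.mk _ a, Ideal.Quotient.mk _ s, by rw [e1, e1, eq_div_iff hs, h]⟩
  have fr2 : IsFractionRing (B ⧸ Q) l := IsFractionRing.of_field _ _ fun c => by
    obtain ⟨a, s, hs, h⟩ := hl c
    exact ⟨Ideal.Quotient.mk _ a, Ideal.Quotient.mk _ s, by rw [e2, e2, eq_div_iff hs, h]⟩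
  have al1 : Algebra.IsAlgebraic (A ⧸ Q.under A) k :=
    IsLocalization.isAlgebraic _ (nonZeroDivisors (A ⧸ Q.under A))
  have al2 : Algebra.IsAlgebraic (B ⧸ Q) l :=
    IsLocalization.isAlgebraic _ (nonZeroDivisors (B ⧸ Q))
  have f3 : FaithfulSMul (A ⧸ Q.under A) (B ⧸ Q) := by
    rw [faithfulSMul_iff_algebraMap_injective]
    intro x y h
    apply inj1
    apply (algebraMap k l).injective
    rw [← IsScalarTower.algebraMap_apply, ← IsScalarTower.algebraMap_apply,
      IsScalarTower.algebraMap_apply _ (B ⧸ Q) l, h, ← IsScalarTower.algebraMap_apply]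
  have h1 := trdeg_add_eq (A ⧸ Q.under A) k (A := l)
  have h2 := trdeg_add_eq (A ⧸ Q.under A) (B ⧸ Q) (A := l)
  rw [trdeg_eq_zero (R := A ⧸ Q.under A) (A := k), zero_add] at h1
  rw [trdeg_eq_zero (R := B ⧸ Q) (A := l), add_zero] at h2
  rw [h1, ← h2]
  rfl
end bridge

section chart
open AlgebraicGeometry

/-- The relative transcendence degree of the residue field extension at `x`. -/
def td {X S : Scheme.{u}} (f : X ⟶ S) (x : X) : Cardinal.{u} :=
  letI := (f.residueFieldMap x).hom.toAlgebra
  Algebra.trdeg (S.residueField (f x)) (X.residueField x)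

lemma evaluation_frac {X : Scheme.{u}} {U : X.Opens} (hU : IsAffineOpen U) (x : X) (hx : x ∈ U)
    (c : X.residueField x) : ∃ a s : Γ(X, U), X.evaluation U x hx s ≠ 0 ∧
      c * X.evaluation U x hx s = X.evaluation U x hx a := by
  obtain ⟨c, rfl⟩ := X.residue_surjective x c
  let := TopCat.Presheaf.algebra_section_stalk X.presheaf (⟨x, hx⟩ : U)
  have := hU.isLocalization_stalk ⟨x, hx⟩
  obtain ⟨⟨a, s⟩, h⟩ := IsLocalization.surj (hU.primeIdealOf ⟨x, hx⟩).asIdeal.primeCompl c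
  refine ⟨a, s, ?_, ?_⟩
  · have hu := IsLocalization.map_units (X.presheaf.stalk x) s
    have := hu.map (X.residue x).hom
    exact this.ne_zero
  · have := congrArg (X.residue x).hom h
    rw [map_mul] at this
    exact this

lemma evaluation_eq_zero_iff {X : Scheme.{u}} {U : X.Opens} (hU : IsAffineOpen U)
    (r : PrimeSpectrum Γ(X, U)) (hx : hU.fromSpec r ∈ U) (b : Γ(X, U)) :
    X.evaluation U (hU.fromSpec r) hx b = 0 ↔ b ∈ r.asIdeal := by
  rw [Scheme.evaluation_eq_zero_iff_notMem_basicOpen]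
  have : hU.fromSpec r ∈ X.basicOpen b ↔ r ∈ PrimeSpectrum.basicOpen b := by
    rw [← hU.fromSpec_preimage_basicOpen]; rfl
  rw [this]
  simp [PrimeSpectrum.mem_basicOpen]

variable {X S : Scheme.{u}} (f : X ⟶ S) {U : X.Opens} {V : S.Opens} (hU : IsAffineOpen U)

lemma fromSpec_mem (r : PrimeSpectrum Γ(X, U)) : hU.fromSpec r ∈ U := by
  have : hU.fromSpec r ∈ Set.range hU.fromSpec := ⟨r, rfl⟩
  rwa [hU.range_fromSpec] at this

lemma exists_fromSpec {x : X} (hx : x ∈ U) : ∃ r : PrimeSpectrum Γ(X, U), hU.fromSpec r = x :=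
  ⟨_, hU.fromSpec_primeIdealOf ⟨x, hx⟩⟩

lemma fromSpec_specializes (r r' : PrimeSpectrum Γ(X, U)) :
    hU.fromSpec r ⤳ hU.fromSpec r' ↔ r ≤ r' := by
  rw [PrimeSpectrum.le_iff_specializes]
  exact hU.fromSpec.isOpenEmbedding.isInducing.specializes_iff

lemma map_fromSpec_apply (hV : IsAffineOpen V) (e : U ≤ f ⁻¹ᵁ V)
    (r : PrimeSpectrum Γ(X, U)) :
    f (hU.fromSpec r) = hV.fromSpec (PrimeSpectrum.comap (f.appLE V U e).hom r) := by
  have := IsAffineOpen.SpecMap_appLE_fromSpec f hV hU e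
  have := congrArg (fun g : Spec Γ(X, U) ⟶ S => g r) this
  exact this.symm

lemma fromSpec_inj {r r' : PrimeSpectrum Γ(X, U)} (h : hU.fromSpec r = hU.fromSpec r') : r = r' :=
  hU.fromSpec.isOpenEmbedding.injective h

lemma map_fromSpec_eq_iff (hV : IsAffineOpen V) (e : U ≤ f ⁻¹ᵁ V)
    (r r' : PrimeSpectrum Γ(X, U)) :
    letI := (f.appLE V U e).hom.toAlgebra
    f (hU.fromSpec r) = f (hU.fromSpec r') ↔
      r.asIdeal.under Γ(S, V) = r'.asIdeal.under Γ(S, V) := by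
  rw [map_fromSpec_apply f hU hV e, map_fromSpec_apply f hU hV e]
  constructor
  · intro h
    exact congrArg PrimeSpectrum.asIdeal (fromSpec_inj hV h)
  · intro h
    congr 1
    exact PrimeSpectrum.ext h

lemma td_fromSpec (hV : IsAffineOpen V) (e : U ≤ f ⁻¹ᵁ V)
    (r : PrimeSpectrum Γ(X, U)) :
    letI := (f.appLE V U e).hom.toAlgebra
    td f (hU.fromSpec r) = relTd Γ(S, V) r.asIdeal := by
  let := (f.appLE V U e).hom.toAlgebra
  let := (f.residueFieldMap (hU.fromSpec r)).hom.toAlgebra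
  have hx := fromSpec_mem hU r
  have hx' : f (hU.fromSpec r) ∈ V := e hx
  refine trdeg_eq_relTd (S.evaluation V _ hx').hom (X.evaluation U _ hx).hom ?_ _
    (evaluation_eq_zero_iff hU r hx) (evaluation_frac hV _ hx') (evaluation_frac hU _ hx)
  intro a
  change X.evaluation U _ hx ((f.appLE V U e).hom a) =
    f.residueFieldMap (hU.fromSpec r) (S.evaluation V _ hx' a)
  rw [Scheme.evaluation_naturality_apply]
  rw [Scheme.Hom.appLE]
  change X.residue _ (X.presheaf.germ U _ hx (X.presheaf.map (homOfLE e).op (f.app V a))) = _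
  rw [TopCat.Presheaf.germ_res_apply]
  rfl

end chart

section topo
open TopologicalSpace

lemma topologicalKrullDim_le_of_td {T : Type*} [TopologicalSpace T] [QuasiSober T]
    (d : T → ℕ) (hd : ∀ x y : T, x ⤳ y → x ≠ y → d y < d x) (ξ : T) (hξ : ∀ y, ξ ⤳ y) :
    topologicalKrullDim T ≤ d ξ := by
  have hmono : StrictMono (fun Z : IrreducibleCloseds T => d Z.isIrreducible.genericPoint) := by
    intro Z W h
    apply hd
    · have h1 := Z.isIrreducible.isGenericPoint_genericPoint Z.isClosed
      have h2 := W.isIrreducible.isGenericPoint_genericPoint W.isClosed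
      rw [specializes_iff_mem_closure, h2.def]
      exact h.le h1.mem
    · intro h'
      have h1 := Z.isIrreducible.isGenericPoint_genericPoint Z.isClosed
      have h2 := W.isIrreducible.isGenericPoint_genericPoint W.isClosed
      apply h.ne
      apply SetLike.coe_injective
      rw [← h1.def, ← h2.def, h']
  refine iSup_le fun p => ?_
  have h := LTSeries.head_add_length_le_nat (p.map _ hmono)
  have h2 : (p.map _ hmono).last ≤ d ξ := by
    change d (p.last.isIrreducible.genericPoint) ≤ d ξ
    by_cases hx : ξ = p.last.isIrreducible.genericPoint
    · rw [← hx]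
    · exact (hd _ _ (hξ _) hx).le
  have h3 : (p.map _ hmono).length = p.length := rfl
  have : p.length ≤ d ξ := by omega
  exact_mod_cast this

lemma krullDim_le_topologicalKrullDim {T : Type*} [TopologicalSpace T] [T0Space T]
    {P : Type*} [PartialOrder P] (φ : P → T) (hφ : ∀ r r', φ r ⤳ φ r' ↔ r ≤ r') :
    Order.krullDim P ≤ topologicalKrullDim T := by
  rw [← Order.krullDim_orderDual]
  refine Order.krullDim_le_of_strictMono
    (fun r : Pᵒᵈ => (⟨closure {φ (OrderDual.ofDual r)}, isIrreducible_singleton.closure,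
      isClosed_closure⟩ : IrreducibleCloseds T)) ?_
  refine Monotone.strictMono_of_injective ?_ ?_
  · intro r r' h
    change closure {φ (OrderDual.ofDual r)} ⊆ closure {φ (OrderDual.ofDual r')}
    rw [← specializes_iff_closure_subset]
    exact (hφ _ _).2 h
  · intro r r' h
    have h' : closure {φ (OrderDual.ofDual r)} = closure {φ (OrderDual.ofDual r')} :=
      congrArg (fun Z : IrreducibleCloseds T => (Z : Set T)) h
    have h1 := (hφ _ _).1 (specializes_iff_closure_subset.2 h'.le)
    have h2 := (hφ _ _).1 (specializes_iff_closure_subset.2 h'.ge)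
    exact OrderDual.ofDual.injective (@le_antisymm P _ _ _ h2 h1)

end topo

section scheme
variable {X S : Scheme.{u}} (f : X ⟶ S)

lemma exists_chart (x : X) : ∃ (V : S.Opens) (_ : IsAffineOpen V) (U : X.Opens)
    (_ : IsAffineOpen U) (_ : U ≤ f ⁻¹ᵁ V), x ∈ U := by
  obtain ⟨V, hV, hxV, -⟩ := exists_isAffineOpen_mem_and_subset (x := f x) (U := ⊤) trivial
  obtain ⟨U, hU, hxU, h⟩ := exists_isAffineOpen_mem_and_subset (x := x) (U := f ⁻¹ᵁ V) hxV
  exact ⟨V, hV, U, hU, h, hxU⟩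

lemma td_lt_aleph0 [LocallyOfFiniteType f] (x : X) : td f x < Cardinal.aleph0 := by
  obtain ⟨V, hV, U, hU, e, hx⟩ := exists_chart f x
  obtain ⟨r, rfl⟩ := exists_fromSpec hU hx
  let := (f.appLE V U e).hom.toAlgebra
  have : Algebra.FiniteType Γ(S, V) Γ(X, U) := Scheme.Hom.finiteType_appLE f hV hU e
  rw [td_fromSpec f hU hV e]
  exact relTd_lt_aleph0 r.asIdeal

lemma td_drop {x y : X} (h : x ⤳ y) (hne : x ≠ y) (hf : f x = f y) : td f y + 1 ≤ td f x := by
  obtain ⟨V, hV, U, hU, e, hy⟩ := exists_chart f y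
  have hx : x ∈ U := h.mem_open U.isOpen hy
  obtain ⟨r, rfl⟩ := exists_fromSpec hU hy
  obtain ⟨q, rfl⟩ := exists_fromSpec hU hx
  let := (f.appLE V U e).hom.toAlgebra
  rw [td_fromSpec f hU hV e, td_fromSpec f hU hV e]
  rw [fromSpec_specializes] at h
  refine relTd_drop _ _ (lt_of_le_of_ne h ?_) ((map_fromSpec_eq_iff f hU hV e _ _).1 hf)
  intro h'
  exact hne (congrArg hU.fromSpec (PrimeSpectrum.ext h'))

lemma fiberι_map (s : S) (y : f.fiber s) : f (f.fiberι s y) = s := by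
  have : f.fiberι s y ∈ Set.range (f.fiberι s) := ⟨y, rfl⟩
  rw [f.range_fiberι] at this
  exact this

lemma exists_fiberι (s : S) (x : X) (h : f x = s) : ∃ y : f.fiber s, f.fiberι s y = x := by
  have : x ∈ Set.range (f.fiberι s) := by rw [f.range_fiberι]; exact h
  exact this

lemma fiberι_specializes (s : S) (x y : f.fiber s) :
    f.fiberι s x ⤳ f.fiberι s y ↔ x ⤳ y :=
  (f.fiberι s).isEmbedding.isInducing.specializes_iff

lemma fiberι_inj (s : S) {x y : f.fiber s} (h : f.fiberι s x = f.fiberι s y) : x = y :=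
  (f.fiberι s).isEmbedding.injective h

lemma dim_le [LocallyOfFiniteType f] (s : S) (Y : Set (f.fiber s)) (hY : IsClosed Y)
    (y : f.fiber s) (hy : closure {y} = Y) :
    topologicalKrullDim ↥Y ≤ (Cardinal.toNat (td f (f.fiberι s y)) : ℕ) := by
  have : QuasiSober Y := hY.isClosedEmbedding_subtypeVal.quasiSober
  have hyY : y ∈ Y := hy ▸ subset_closure rfl
  refine topologicalKrullDim_le_of_td (fun z : Y => Cardinal.toNat (td f (f.fiberι s z.1))) ?_
    ⟨y, hyY⟩ ?_
  · intro a b hab hne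
    have h := td_drop f (x := f.fiberι s a.1) (y := f.fiberι s b.1)
      ((fiberι_specializes f s _ _).2 (hab.map continuous_subtype_val))
      (fun h => hne (Subtype.ext (fiberι_inj f s h))) (by rw [fiberι_map, fiberι_map])
    have ha := td_lt_aleph0 f (f.fiberι s a.1)
    have hb := td_lt_aleph0 f (f.fiberι s b.1)
    rw [← Cardinal.cast_toNat_of_lt_aleph0 ha, ← Cardinal.cast_toNat_of_lt_aleph0 hb] at h
    have : Cardinal.toNat (td f (f.fiberι s b.1)) + 1 ≤ Cardinal.toNat (td f (f.fiberι s a.1)) := by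
      exact_mod_cast h
    exact this
  · intro z
    rw [Topology.IsInducing.subtypeVal.specializes_iff.symm]
    rw [specializes_iff_mem_closure, hy]
    exact z.2

lemma le_dim [LocallyOfFiniteType f] [IsIntegral S] {U : X.Opens} {V : S.Opens}
    (hU : IsAffineOpen U)
    (hV : IsAffineOpen V) (e : U ≤ f ⁻¹ᵁ V) (η : S) (P : PrimeSpectrum Γ(X, U))
    (hP : letI := (f.appLE V U e).hom.toAlgebra; P.asIdeal.under Γ(S, V) = ⊥)
    (hη : f (hU.fromSpec P) = η)
    (n : ℕ) (hn : (n : Cardinal) ≤ td f (hU.fromSpec P)) (Y : Set (f.fiber η)) (hY : IsClosed Y)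
    (y : f.fiber η) (hyY : y ∈ Y) (hy : f.fiberι η y = hU.fromSpec P) :
    (n : WithBot ℕ∞) ≤ topologicalKrullDim ↥Y := by
  let := (f.appLE V U e).hom.toAlgebra
  have : Algebra.FiniteType Γ(S, V) Γ(X, U) := Scheme.Hom.finiteType_appLE f hV hU e
  have : Nonempty V := ⟨⟨f (hU.fromSpec P), e (fromSpec_mem hU P)⟩⟩
  rw [td_fromSpec f hU hV e] at hn
  refine (le_krullDim_of_le_relTd P.asIdeal hP n hn).trans ?_
  have key : ∀ r : {r : PrimeSpectrum Γ(X, U) // P.asIdeal ≤ r.asIdeal ∧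
      r.asIdeal.under Γ(S, V) = ⊥}, ∃ z : Y, f.fiberι η z.1 = hU.fromSpec r.1 := by
    rintro ⟨r, hr1, hr2⟩
    have h1 : f (hU.fromSpec r) = η := by
      rw [← hη]
      exact (map_fromSpec_eq_iff f hU hV e _ _).2 (by rw [hr2, hP])
    obtain ⟨z, hz⟩ := exists_fiberι f η _ h1
    refine ⟨⟨z, ?_⟩, hz⟩
    have : y ⤳ z := by
      rw [← fiberι_specializes, hy, hz, fromSpec_specializes]
      exact hr1
    exact this.mem_closed hY hyY
  choose φ hφ using key
  refine krullDim_le_topologicalKrullDim φ fun r r' => ?_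
  rw [← Topology.IsInducing.subtypeVal.specializes_iff, ← fiberι_specializes, hφ, hφ,
    fromSpec_specializes]
  rfl

end scheme

section assembly
variable {X S : Scheme.{u}} (f : X ⟶ S)

lemma eq_of_maximal [IsIntegral S] [LocallyOfFiniteType f] [Flat f]
    (η : S) (hη : closure {η} = Set.univ)
    (hpure : ∀ Z₁ ∈ irreducibleComponents ↑(f.fiber η), ∀ Z₂ ∈ irreducibleComponents ↑(f.fiber η),
        topologicalKrullDim ↥Z₁ = topologicalKrullDim ↥Z₂)
    (Y : Set (f.fiber η)) (hY : Y ∈ irreducibleComponents ↑(f.fiber η))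
    (ξ : f.fiber η) (hξ : closure {ξ} = Y) (s : S) (w z : f.fiber s)
    (hw : f.fiberι η ξ ⤳ f.fiberι s w)
    (hmax : ∀ v : f.fiber s, f.fiberι η ξ ⤳ f.fiberι s v → v ⤳ w → v = w)
    (hz : z ⤳ w) : z = w := by
  by_contra hne
  obtain ⟨V, hV, U, hU, e, hwU⟩ := exists_chart f (f.fiberι s w)
  have hξU : f.fiberι η ξ ∈ U := hw.mem_open U.isOpen hwU
  have hz' : f.fiberι s z ⤳ f.fiberι s w := (fiberι_specializes f s _ _).2 hz
  have hzU : f.fiberι s z ∈ U := hz'.mem_open U.isOpen hwU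
  obtain ⟨Q, hQ⟩ := exists_fromSpec hU hwU
  obtain ⟨P, hP⟩ := exists_fromSpec hU hξU
  obtain ⟨Q', hQ'⟩ := exists_fromSpec hU hzU
  let := (f.appLE V U e).hom.toAlgebra
  have : Algebra.FiniteType Γ(S, V) Γ(X, U) := Scheme.Hom.finiteType_appLE f hV hU e
  have : Module.Flat Γ(S, V) Γ(X, U) := Scheme.Hom.flat_appLE f hV hU e
  have : Nonempty V := ⟨⟨f (hU.fromSpec P), e (fromSpec_mem hU P)⟩⟩
  rw [← hP, ← hQ, fromSpec_specializes] at hw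
  rw [← hQ', ← hQ, fromSpec_specializes] at hz'
  have fP : f (hU.fromSpec P) = η := by rw [hP, fiberι_map]
  have fQ : f (hU.fromSpec Q) = s := by rw [hQ, fiberι_map]
  have fQ' : f (hU.fromSpec Q') = s := by rw [hQ', fiberι_map]
  have hPbot : P.asIdeal.under Γ(S, V) = ⊥ := by
    have h1 := map_fromSpec_apply f hU hV e P
    rw [fP] at h1
    have h2 : η ⤳ hV.fromSpec (⊥ : PrimeSpectrum Γ(S, V)) := by
      rw [specializes_iff_mem_closure, hη]
      trivial
    rw [h1, fromSpec_specializes] at h2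
    have h3 : PrimeSpectrum.comap (f.appLE V U e).hom P = ⊥ := le_bot_iff.1 h2
    exact congrArg PrimeSpectrum.asIdeal h3
  obtain ⟨P', hP'1, hP'2, hP'3⟩ := exists_relTd_lt (A := Γ(S, V)) P.asIdeal Q.asIdeal Q'.asIdeal hw
    (by
      intro r hr h1 h2 h3
      have fr : f (hU.fromSpec ⟨r, hr⟩) = s := by
        rw [← fQ]
        exact (map_fromSpec_eq_iff f hU hV e _ _).2 h3
      obtain ⟨v, hv⟩ := exists_fiberι f s _ fr
      have hvw : v = w := by
        apply hmax
        · rw [hv, ← hP, fromSpec_specializes]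
          exact h1
        · rw [← fiberι_specializes, hv, ← hQ, fromSpec_specializes]
          exact h2
      rw [hvw, ← hQ] at hv
      exact congrArg PrimeSpectrum.asIdeal (fromSpec_inj hU hv).symm)
    (lt_of_le_of_ne hz' (by
      intro h
      apply hne
      apply fiberι_inj f s
      rw [← hQ, ← hQ', PrimeSpectrum.ext h]))
    ((map_fromSpec_eq_iff f hU hV e _ _).1 (by rw [fQ, fQ']))
  have fP' : f (hU.fromSpec ⟨P', hP'1⟩) = η := by
    rw [← fP]
    exact (map_fromSpec_eq_iff f hU hV e _ _).2 (by rw [hPbot]; exact hP'2)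
  obtain ⟨y', hy'⟩ := exists_fiberι f η _ fP'
  have hd : td f (hU.fromSpec P) = relTd Γ(S, V) P.asIdeal := td_fromSpec f hU hV e P
  have hd' : td f (hU.fromSpec ⟨P', hP'1⟩) = relTd Γ(S, V) P' := td_fromSpec f hU hV e _
  rw [← hd, ← hd', ← Cardinal.cast_toNat_of_lt_aleph0 (td_lt_aleph0 f (hU.fromSpec P))] at hP'3
  have h1 := le_dim f hU hV e η ⟨P', hP'1⟩ hP'2 fP'
    (Cardinal.toNat (td f (hU.fromSpec P)) + 1) (by exact_mod_cast hP'3)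
    (irreducibleComponent y') isClosed_irreducibleComponent y' mem_irreducibleComponent hy'
  rw [hpure _ (irreducibleComponent_mem_irreducibleComponents y') _ hY] at h1
  have h2 := h1.trans (dim_le f η Y (isClosed_of_mem_irreducibleComponents _ hY) ξ hξ)
  rw [hP] at h2
  have h3 : Cardinal.toNat (td f (f.fiberι η ξ)) + 1 ≤ Cardinal.toNat (td f (f.fiberι η ξ)) := by
    exact_mod_cast h2
  omega

lemma component_generic {T : Type*} [TopologicalSpace T] [QuasiSober T] {Z : Set T}
    (hZ : Z ∈ irreducibleComponents T) : ∃ z, closure {z} = Z :=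
  ⟨_, (hZ.1.isGenericPoint_genericPoint (isClosed_of_mem_irreducibleComponents _ hZ)).def⟩

/-- Every point of a closed subset of a quasi-sober `T0` space is a specialization of a point of
that closed subset which is maximal for generization. -/
lemma exists_maximal_generization {T : Type*} [TopologicalSpace T] [QuasiSober T] [T0Space T]
    {F : Set T} (hF : IsClosed F) {x : T} (hx : x ∈ F) :
    ∃ w ∈ F, w ⤳ x ∧ ∀ v ∈ F, v ⤳ w → v = w := by
  have : QuasiSober F := hF.isClosedEmbedding_subtypeVal.quasiSober
  obtain ⟨w, hw⟩ := component_generic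
    (irreducibleComponent_mem_irreducibleComponents (⟨x, hx⟩ : F))
  have hwx : w ⤳ ⟨x, hx⟩ := by
    rw [specializes_iff_mem_closure, hw]
    exact mem_irreducibleComponent
  refine ⟨w.1, w.2, hwx.map continuous_subtype_val, fun v hv hvw => ?_⟩
  have h1 : (⟨v, hv⟩ : F) ⤳ w := Topology.IsInducing.subtypeVal.specializes_iff.1 hvw
  have h2 : irreducibleComponent (⟨x, hx⟩ : F) ⊆ closure {(⟨v, hv⟩ : F)} := by
    rw [← hw]
    exact specializes_iff_closure_subset.1 h1
  have h3 := eq_irreducibleComponent isIrreducible_singleton.closure.isPreirreducible h2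
  rw [← hw] at h3
  have h4 : w ⤳ (⟨v, hv⟩ : F) := specializes_iff_closure_subset.2 h3.le
  exact congrArg Subtype.val (Specializes.antisymm h1 h4).eq

theorem main_aux [IsIntegral S] [LocallyOfFiniteType f] [Flat f]
    (η : S) (hη : closure {η} = Set.univ)
    (hpure : ∀ Z₁ ∈ irreducibleComponents ↑(f.fiber η), ∀ Z₂ ∈ irreducibleComponents ↑(f.fiber η),
        topologicalKrullDim ↥Z₁ = topologicalKrullDim ↥Z₂)
    (Y : Set (f.fiber η)) (hY : Y ∈ irreducibleComponents ↑(f.fiber η)) (s : S) :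
      (∃ C ⊆ irreducibleComponents ↑(f.fiber s),
        (f.fiberι s) ⁻¹' closure ((f.fiberι η) '' Y) = ⋃₀ C) ∧
      (∀ Z ∈ irreducibleComponents ↑(f.fiber s),
        ∃ Y' ∈ irreducibleComponents ↑(f.fiber η),
          Z ⊆ (f.fiberι s) ⁻¹' closure ((f.fiberι η) '' Y')) := by
  have hmem : ∀ (ξ : f.fiber η) (y : X),
      y ∈ closure (f.fiberι η '' closure {ξ}) ↔ f.fiberι η ξ ⤳ y := by
    intro ξ y
    rw [specializes_iff_mem_closure, closure_image_closure (f.fiberι η).continuous,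
      Set.image_singleton]
  constructor
  · obtain ⟨ξ, hξ⟩ := component_generic hY
    set F := (f.fiberι s) ⁻¹' closure ((f.fiberι η) '' Y) with hFdef
    have hF : IsClosed F := isClosed_closure.preimage (f.fiberι s).continuous
    have hFmem : ∀ v, v ∈ F ↔ f.fiberι η ξ ⤳ f.fiberι s v := by
      intro v
      rw [hFdef, Set.mem_preimage, ← hξ, hmem]
    refine ⟨{Z ∈ irreducibleComponents ↑(f.fiber s) | Z ⊆ F}, fun Z hZ => hZ.1, ?_⟩
    apply Set.Subset.antisymm
    · intro x hx
      obtain ⟨w, hw, hwx, hmax⟩ := exists_maximal_generization hF hx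
      obtain ⟨z, hz⟩ := component_generic (irreducibleComponent_mem_irreducibleComponents w)
      have hzw : z ⤳ w := by
        rw [specializes_iff_mem_closure, hz]
        exact mem_irreducibleComponent
      have := eq_of_maximal f η hη hpure Y hY ξ hξ s w z ((hFmem w).1 hw)
        (fun v hv => hmax v ((hFmem v).2 hv)) hzw
      subst this
      refine ⟨irreducibleComponent z, ⟨irreducibleComponent_mem_irreducibleComponents z, ?_⟩, ?_⟩
      · rw [← hz]
        exact closure_minimal (Set.singleton_subset_iff.2 hw) hF
      · rw [← hz]
        exact specializes_iff_mem_closure.1 hwx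
    · exact Set.sUnion_subset fun Z hZ => hZ.2
  · intro Z hZ
    obtain ⟨z, rfl⟩ := component_generic hZ
    have h1 : η ⤳ f (f.fiberι s z) := by
      rw [specializes_iff_mem_closure, hη]
      trivial
    obtain ⟨x, hx, hfx⟩ := Flat.generalizingMap f h1
    obtain ⟨y, rfl⟩ := exists_fiberι f η x hfx
    refine ⟨irreducibleComponent y, irreducibleComponent_mem_irreducibleComponents y, ?_⟩
    refine closure_minimal (Set.singleton_subset_iff.2 ?_)
      (isClosed_closure.preimage (f.fiberι s).continuous)
    have h2 : f.fiberι s z ∈ closure {f.fiberι η y} := specializes_iff_mem_closure.1 hx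
    have h3 : f.fiberι η y ∈ f.fiberι η '' irreducibleComponent y :=
      ⟨y, mem_irreducibleComponent, rfl⟩
    exact closure_mono (Set.singleton_subset_iff.2 h3) h2

end assembly

/-- Lemma 3.1 of the paper.  Let `f : X ⟶ S` be a proper flat morphism
with reduced, pure dimensional fibres over a locally Noetherian integral scheme `S` with
generic point `η`.  If `Y` is an irreducible component of `X_η` and `Ȳ` its closure in
`X`, then for every `s ∈ S` the fibre `Ȳ_s` is a union of irreducible components of
`X_s`; moreover every irreducible component of `X_s` is contained in `Ȳ'_s` for some
irreducible component `Y'` of `X_η`. -/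
theorem closure_fibre_is_union_of_components
    {X S : Scheme.{u}} (f : X ⟶ S) [IsIntegral S] [IsLocallyNoetherian S]
    (η : S) (hη : closure {η} = Set.univ)
    (hproper : IsProper f) (hflat : SchemeFlat f)
    (hred : ∀ s : S, IsReduced (fiberScheme f s))
    (hpure : ∀ s : S, ∀ Z₁ ∈ irreducibleComponents ↑(fiberScheme f s),
      ∀ Z₂ ∈ irreducibleComponents ↑(fiberScheme f s),
        topologicalKrullDim ↥Z₁ = topologicalKrullDim ↥Z₂)
    (Y : Set (fiberScheme f η)) (hY : Y ∈ irreducibleComponents ↑(fiberScheme f η)) :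
    ∀ s : S,
      (∃ C ⊆ irreducibleComponents ↑(fiberScheme f s),
        (fiberι f s).base ⁻¹' closure ((fiberι f η).base '' Y) = ⋃₀ C) ∧
      (∀ Z ∈ irreducibleComponents ↑(fiberScheme f s),
        ∃ Y' ∈ irreducibleComponents ↑(fiberScheme f η),
          Z ⊆ (fiberι f s).base ⁻¹' closure ((fiberι f η).base '' Y')) := by
  have hfl : Flat f := Flat.of_stalkMap f fun x => hflat x
  exact main_aux f η hη (hpure η) Y hY

end NeronSemistable
end
end
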